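/- Let n ≥ 1, let Ω ⊂ ℍⁿ be a bounded open set, and let Σ be a non-empty open subset of S^{2n×2n} satisfying: (i) A ∈ Σ, B ∈ S^{2n×2n}, B positive definite imply A + B ∈ Σ; (ii) A ∈ Σ and c > 0 imply cA ∈ Σ. Let F[ψ] = ∇²_{H,s}ψ + L(ψ, ∇_H ψ) where L(s,p) = α p⊗p − γ Jp⊗Jp − β |p|² I₂ₙ with constants α, β, γ ∈ ℝ satisfying: either β > 0 and γ ≥ 0, or β < 0 and γ ≤ 0, or β = γ = 0. Then for any φ ∈ C⁰(∂Ω) there exists at most one viscosity solution ψ ∈ C⁰(Ω̄) of F[ψ] ∈ ∂Σ in Ω satisfying ψ = φ on ∂Ω. -/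

import Mathlib

open Filter Topology Matrix Asymptotics

noncomputable section

/-- Points of the Heisenberg group `ℍⁿ`: `(x, y, t) ∈ ℝⁿ × ℝⁿ × ℝ`. -/
abbrev Heis (n : ℕ) : Type := (Fin n → ℝ) × (Fin n → ℝ) × ℝ

/-- Index type for the `2n` horizontal directions. -/
abbrev HIdx (n : ℕ) : Type := Fin n ⊕ Fin n

/-- `2n × 2n` real matrices. -/
abbrev HMat (n : ℕ) : Type := Matrix (HIdx n) (HIdx n) ℝ

namespace Heis

variable {n : ℕ}

/-- The Heisenberg group law. -/
def hmul (ξ η : Heis n) : Heis n :=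
  (ξ.1 + η.1, ξ.2.1 + η.2.1,
    ξ.2.2 + η.2.2 + 2 * ∑ i, (ξ.2.1 i * η.1 i - ξ.1 i * η.2.1 i))

/-- The group inverse `ξ⁻¹ = -ξ`. -/
def hinv (ξ : Heis n) : Heis n := (-ξ.1, -ξ.2.1, -ξ.2.2)

/-- `|z|²` for `ξ = (z, t)`. -/
def zsq (ξ : Heis n) : ℝ := ∑ i, (ξ.1 i ^ 2 + ξ.2.1 i ^ 2)

/-- The homogeneous norm `|ξ|_H = (|z|⁴ + t²)^{1/4}`. -/
def hnorm (ξ : Heis n) : ℝ := (zsq ξ ^ 2 + ξ.2.2 ^ 2) ^ ((1 : ℝ) / 4)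

/-- The left-invariant horizontal vector fields `X_j` (for `Sum.inl j`)
and `Y_j` (for `Sum.inr j`), as tangent vectors at `ξ`. -/
def vecField (j : HIdx n) (ξ : Heis n) : Heis n :=
  match j with
  | Sum.inl j => (Pi.single j 1, 0, 2 * ξ.2.1 j)
  | Sum.inr j => (0, Pi.single j 1, -(2 * ξ.1 j))

/-- Horizontal (Heisenberg) gradient `∇_H ψ (ξ) ∈ ℝ^{2n}`. -/
def hGrad (ψ : Heis n → ℝ) (ξ : Heis n) : HIdx n → ℝ :=
  fun j => fderiv ℝ ψ ξ (vecField j ξ)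

/-- Heisenberg Hessian: entry `(i, j)` is `(field j)((field i) ψ)(ξ)`. -/
def hHess (ψ : Heis n → ℝ) (ξ : Heis n) : HMat n :=
  Matrix.of fun i j =>
    fderiv ℝ (fun η => fderiv ℝ ψ η (vecField i η)) ξ (vecField j ξ)

/-- Symmetrized Heisenberg Hessian `∇²_{H,s} ψ`. -/
def hHessSym (ψ : Heis n → ℝ) (ξ : Heis n) : HMat n :=
  ((1 : ℝ) / 2) • (hHess ψ ξ + (hHess ψ ξ)ᵀ)

/-- The standard symplectic matrix `J = [[0, Iₙ], [-Iₙ, 0]]`. -/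
def Jmat (n : ℕ) : HMat n :=
  Matrix.of fun i j =>
    match i, j with
    | Sum.inl a, Sum.inr b => if a = b then (1 : ℝ) else 0
    | Sum.inr a, Sum.inl b => if a = b then (-1 : ℝ) else 0
    | _, _ => 0

/-- Euclidean norm of `p ∈ ℝ^{2n}`. -/
def pnorm (p : HIdx n → ℝ) : ℝ := Real.sqrt (∑ j, p j ^ 2)

/-- The Loewner (positive semidefinite) order on matrices. -/
def matLE (A B : HMat n) : Prop := (B - A).PosSemidef

/-- The operator `F[ψ] = ∇²_{H,s} ψ + L(·, ψ, ∇_H ψ)`. -/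
def Fop (L : Heis n → ℝ → (HIdx n → ℝ) → HMat n) (ψ : Heis n → ℝ) (ξ : Heis n) : HMat n :=
  hHessSym ψ ξ + L ξ (ψ ξ) (hGrad ψ ξ)

/-- Viscosity subsolution of `F[ψ] ∈ ∂Σ` in `Ω`: `F[ψ] ∈ closure Σ`
in the viscosity sense. -/
def IsSubsolution (Ω : Set (Heis n)) (L : Heis n → ℝ → (HIdx n → ℝ) → HMat n)
    (S : Set (HMat n)) (v : Heis n → EReal) : Prop :=
  ∀ ξ₀ ∈ Ω, ∀ φ : Heis n → ℝ, ContDiffOn ℝ 2 φ Ω → v ξ₀ = ((φ ξ₀ : ℝ) : EReal) →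
    (∀ᶠ η in nhds ξ₀, η ∈ Ω → v η ≤ ((φ η : ℝ) : EReal)) →
    Fop L φ ξ₀ ∈ closure S

/-- Viscosity supersolution of `F[ψ] ∈ ∂Σ` in `Ω`: `F[ψ] ∈ S^{2n×2n} ∖ Σ`
in the viscosity sense. -/
def IsSupersolution (Ω : Set (Heis n)) (L : Heis n → ℝ → (HIdx n → ℝ) → HMat n)
    (S : Set (HMat n)) (w : Heis n → EReal) : Prop :=
  ∀ ξ₀ ∈ Ω, ∀ φ : Heis n → ℝ, ContDiffOn ℝ 2 φ Ω → w ξ₀ = ((φ ξ₀ : ℝ) : EReal) →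
    (∀ᶠ η in nhds ξ₀, η ∈ Ω → ((φ η : ℝ) : EReal) ≤ w η) →
    Fop L φ ξ₀ ∉ S

/-- The class `USC(s)`: upper semicontinuous, valued in `ℝ ∪ {-∞}`, not identically `-∞`. -/
def USCFun (s : Set (Heis n)) (v : Heis n → EReal) : Prop :=
  UpperSemicontinuousOn v s ∧ (∀ ξ ∈ s, v ξ ≠ ⊤) ∧ (∃ ξ ∈ s, v ξ ≠ ⊥)

/-- The class `LSC(s)`: lower semicontinuous, valued in `ℝ ∪ {+∞}`, not identically `+∞`. -/
def LSCFun (s : Set (Heis n)) (w : Heis n → EReal) : Prop :=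
  LowerSemicontinuousOn w s ∧ (∀ ξ ∈ s, w ξ ≠ ⊥) ∧ (∃ ξ ∈ s, w ξ ≠ ⊤)

/-- `Σ` is (relatively) open as a subset of the space of symmetric matrices. -/
def RelOpen (S : Set (HMat n)) : Prop :=
  IsOpen {A : {M : HMat n // M.IsSymm} | A.1 ∈ S}

/-- The quadratic lower-order term
`L(ξ,s,p) = α(ξ,s) p⊗p - γ(ξ,s) Jp⊗Jp - β(ξ,s)|p|² I₂ₙ`. -/
def Lquad (α β γ : Heis n → ℝ → ℝ) : Heis n → ℝ → (HIdx n → ℝ) → HMat n :=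
  fun ξ s p =>
    α ξ s • vecMulVec p p - γ ξ s • vecMulVec (Jmat n *ᵥ p) (Jmat n *ᵥ p)
      - (β ξ s * ∑ j, p j ^ 2) • (1 : HMat n)

/-- The quadratic lower-order term with constant coefficients
`L(s,p) = a p⊗p - c Jp⊗Jp - b|p|² I₂ₙ`. -/
def LquadC (a b c : ℝ) : Heis n → ℝ → (HIdx n → ℝ) → HMat n :=
  fun _ _ p =>
    a • vecMulVec p p - c • vecMulVec (Jmat n *ᵥ p) (Jmat n *ᵥ p)
      - (b * ∑ j, p j ^ 2) • (1 : HMat n)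

/-- Locally Lipschitz on a set. -/
def LocallyLipschitzOnSet {X : Type*} [PseudoMetricSpace X] (s : Set X) (f : X → ℝ) : Prop :=
  ∀ x ∈ s, ∃ K : NNReal, ∃ t ∈ nhdsWithin x s, LipschitzOnWith K f t

/-- All entries of `L(ξ,s,·)` are differentiable at `p`. -/
def DiffInP (L : Heis n → ℝ → (HIdx n → ℝ) → HMat n) (ξ : Heis n) (s : ℝ)
    (p : HIdx n → ℝ) : Prop :=
  ∀ i j, DifferentiableAt ℝ (fun q => L ξ s q i j) p

/-- All entries of `L(·,s,p)` are differentiable at `ξ`. -/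
def DiffInXi (L : Heis n → ℝ → (HIdx n → ℝ) → HMat n) (ξ : Heis n) (s : ℝ)
    (p : HIdx n → ℝ) : Prop :=
  ∀ i j, DifferentiableAt ℝ (fun η => L η s p i j) ξ

/-- A norm of `∇_p L(ξ,s,p)`. -/
def pGradNorm (L : Heis n → ℝ → (HIdx n → ℝ) → HMat n) (ξ : Heis n) (s : ℝ)
    (p : HIdx n → ℝ) : ℝ :=
  Real.sqrt (∑ i, ∑ j, ∑ k, (fderiv ℝ (fun q => L ξ s q i j) p (Pi.single k 1)) ^ 2)

/-- A norm of `∇_ξ L(ξ,s,p)`. -/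
def xiGradNorm (L : Heis n → ℝ → (HIdx n → ℝ) → HMat n) (ξ : Heis n) (s : ℝ)
    (p : HIdx n → ℝ) : ℝ :=
  Real.sqrt (∑ i : HIdx n, ∑ j : HIdx n, ‖fderiv ℝ (fun η => L η s p i j) ξ‖ ^ 2)

/-- The matrix `p · ∇_p L(ξ,s,p)`. -/
def pDotGradL (L : Heis n → ℝ → (HIdx n → ℝ) → HMat n) (ξ : Heis n) (s : ℝ)
    (p : HIdx n → ℝ) : HMat n :=
  Matrix.of fun i j => fderiv ℝ (fun q => L ξ s q i j) p p

/-- Structural condition (3.3): `|∇_ξ L(ξ,s,p)| ≤ C|p|^m` and `|∇_p L(ξ,s,p)| ≤ C|p|`. -/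
def Cond33 (Ω : Set (Heis n)) (L : Heis n → ℝ → (HIdx n → ℝ) → HMat n) (m : ℝ) : Prop :=
  ∀ R : ℝ, 0 < R → ∃ C : ℝ, 0 < C ∧ ∀ ξ ∈ Ω, ∀ s : ℝ, |s| ≤ R → ∀ p : HIdx n → ℝ,
    (DiffInXi L ξ s p → xiGradNorm L ξ s p ≤ C * pnorm p ^ m) ∧
    (DiffInP L ξ s p → pGradNorm L ξ s p ≤ C * pnorm p)

/-- Structural condition (3.4): `0 ≤ L(ξ,s',p) - L(ξ,s,p) ≤ C(s'-s)|p|^m I₂ₙ`. -/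
def Cond34 (Ω : Set (Heis n)) (L : Heis n → ℝ → (HIdx n → ℝ) → HMat n) (m : ℝ) : Prop :=
  ∀ R : ℝ, 0 < R → ∃ C : ℝ, 0 < C ∧ ∀ ξ ∈ Ω, ∀ s s' : ℝ, -R ≤ s → s ≤ s' → s' ≤ R →
    ∀ p : HIdx n → ℝ,
      matLE 0 (L ξ s' p - L ξ s p) ∧
      matLE (L ξ s' p - L ξ s p) ((C * (s' - s) * pnorm p ^ m) • (1 : HMat n))

/-- The second inequality of condition (3.4): `L(ξ,s',p) - L(ξ,s,p) ≤ C(s'-s)|p|^m I₂ₙ`. -/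
def Cond34Upper (Ω : Set (Heis n)) (L : Heis n → ℝ → (HIdx n → ℝ) → HMat n) (m : ℝ) : Prop :=
  ∀ R : ℝ, 0 < R → ∃ C : ℝ, 0 < C ∧ ∀ ξ ∈ Ω, ∀ s s' : ℝ, -R ≤ s → s ≤ s' → s' ≤ R →
    ∀ p : HIdx n → ℝ,
      matLE (L ξ s' p - L ξ s p) ((C * (s' - s) * pnorm p ^ m) • (1 : HMat n))

/-- Structural condition (3.5). -/
def Cond35 (Ω : Set (Heis n)) (L : Heis n → ℝ → (HIdx n → ℝ) → HMat n) (m : ℝ) : Prop :=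
  ∀ R : ℝ, 0 < R → ∀ Λ : ℝ, 0 < Λ → ∃ θb : ℝ, 0 < θb ∧ ∃ C : ℝ, 0 < C ∧
    ∀ θ : ℝ, 0 ≤ θ → θ ≤ θb → ∀ ξ ∈ Ω, ∀ s : ℝ, |s| ≤ R → ∀ p : HIdx n → ℝ,
      DiffInP L ξ s p →
      matLE (pDotGradL L ξ s p - L ξ s p + (θ * Λ * pGradNorm L ξ s p) • (1 : HMat n)
              - θ • (1 : HMat n))
            (C • vecMulVec p p - ((1 / C) * pnorm p ^ m) • (1 : HMat n))

/-- Structural condition (3.7). -/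
def Cond37 (Ω : Set (Heis n)) (L : Heis n → ℝ → (HIdx n → ℝ) → HMat n) (m : ℝ) : Prop :=
  ∀ R : ℝ, 0 < R → ∀ Λ : ℝ, 0 < Λ → ∃ θb : ℝ, 0 < θb ∧ ∃ C : ℝ, 0 < C ∧
    ∀ θ : ℝ, 0 < θ → θ ≤ θb → ∀ ξ ∈ Ω, ∀ s : ℝ, |s| ≤ R → ∀ p : HIdx n → ℝ,
      DiffInP L ξ s p →
      matLE ((-C) • vecMulVec p p + ((1 / C) * pnorm p ^ m) • (1 : HMat n))
            (pDotGradL L ξ s p - L ξ s p - (θ * Λ * pGradNorm L ξ s p) • (1 : HMat n)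
              + θ • (1 : HMat n))

/-- `P` is a second-order Taylor witness for `u` at `ξ`: `u` is punctually second order
differentiable at `ξ` with expansion given by the `C²` function `P`. -/
def PunctualWitness (u P : Heis n → ℝ) (ξ : Heis n) : Prop :=
  ContDiff ℝ 2 P ∧ P ξ = u ξ ∧
    (fun η => u η - P η) =o[nhds ξ] (fun η => ‖η - ξ‖ ^ 2)

/-- The `ε`-lower envelope `w_ε`. -/
def lowerEnv (Ω : Set (Heis n)) (w : Heis n → EReal) (ε : ℝ) (ξ : Heis n) : EReal :=
  ⨅ η ∈ closure Ω, (w η + (((1 / ε) * hnorm (hmul (hinv η) ξ) ^ 4 : ℝ) : EReal))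

/-- The `ε`-upper envelope `v^ε`. -/
def upperEnv (Ω : Set (Heis n)) (v : Heis n → EReal) (ε : ℝ) (ξ : Heis n) : EReal :=
  ⨆ η ∈ closure Ω, (v η - (((1 / ε) * hnorm (hmul (hinv η) ξ) ^ 4 : ℝ) : EReal))

/-- The `ε`-lower envelope, as a real valued function. -/
def lowerEnvR (Ω : Set (Heis n)) (w : Heis n → EReal) (ε : ℝ) (ξ : Heis n) : ℝ :=
  (lowerEnv Ω w ε ξ).toReal

/-- The `ε`-upper envelope, as a real valued function. -/
def upperEnvR (Ω : Set (Heis n)) (v : Heis n → EReal) (ε : ℝ) (ξ : Heis n) : ℝ :=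
  (upperEnv Ω v ε ξ).toReal

/-- The lower semicontinuous envelope `g_*` relative to `O`. -/
def lscEnv (O : Set (Heis n)) (g : Heis n → EReal) (ξ : Heis n) : EReal :=
  ⨆ (r : ℝ) (_ : 0 < r), ⨅ η ∈ O ∩ Metric.ball ξ r, g η

/-- The upper semicontinuous envelope `g^*` relative to `O`. -/
def uscEnv (O : Set (Heis n)) (g : Heis n → EReal) (ξ : Heis n) : EReal :=
  ⨅ (r : ℝ) (_ : 0 < r), ⨆ η ∈ O ∩ Metric.ball ξ r, g η

end Heis

open Heis

section AbstractJensen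

open MeasureTheory

variable {V : Type*} [NormedAddCommGroup V] [NormedSpace ℝ V]

/-- Uniqueness of slopes for a function touched from both sides by paraboloids. -/
lemma slope_unique {Ω : Set V} (hΩ : IsOpen Ω) {x : V} (hx : x ∈ Ω) {K : ℝ}
    {p q : V →L[ℝ] ℝ} (h : ∀ y ∈ Ω, p (y - x) ≤ q (y - x) + K * ‖y - x‖ ^ 2) : p = q := by
  have key : ∀ v, p v ≤ q v := by
    intro v
    have hcont : Tendsto (fun t : ℝ => x + t • v) (𝓝 0) (𝓝 x) := by
      have : Continuous (fun t : ℝ => x + t • v) := by fun_prop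
      simpa using this.tendsto 0
    have hev : ∀ᶠ t in 𝓝[>] (0:ℝ), x + t • v ∈ Ω :=
      (hcont.eventually (hΩ.mem_nhds hx)).filter_mono nhdsWithin_le_nhds
    have hev2 : ∀ᶠ t in 𝓝[>] (0:ℝ), p v ≤ q v + t * (K * ‖v‖ ^ 2) := by
      filter_upwards [hev, self_mem_nhdsWithin] with t ht ht0
      have ht0' : (0:ℝ) < t := ht0
      have := h _ ht
      simp only [add_sub_cancel_left, map_smul, smul_eq_mul, norm_smul, Real.norm_eq_abs,
        mul_pow, sq_abs] at this
      have h2 : t * p v ≤ t * (q v + t * (K * ‖v‖ ^ 2)) := by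
        calc t * p v ≤ t * q v + K * (t ^ 2 * ‖v‖ ^ 2) := this
          _ = _ := by ring
      exact le_of_mul_le_mul_left h2 ht0'
    have hlim : Tendsto (fun t : ℝ => q v + t * (K * ‖v‖ ^ 2)) (𝓝[>] 0) (𝓝 (q v)) := by
      have : Continuous (fun t : ℝ => q v + t * (K * ‖v‖ ^ 2)) := by fun_prop
      have h3 := this.tendsto 0
      simp only [zero_mul, add_zero] at h3
      exact h3.mono_left nhdsWithin_le_nhds
    exact ge_of_tendsto hlim hev2
  ext v
  apply le_antisymm (key v)
  have := key (-v)
  simp only [map_neg, neg_le_neg_iff] at this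
  exact this

/-- Gradients at points with two-sided paraboloid bounds are Lipschitz. -/
lemma slope_lipschitz {Ω E : Set V} {ρ D K : ℝ} (hρ : 0 < ρ) (hK : 0 ≤ K)
    (hball : ∀ x ∈ E, Metric.closedBall x ρ ⊆ Ω) (hD : ∀ x ∈ E, ∀ y ∈ E, ‖x - y‖ ≤ D)
    {g : V → ℝ} {p : V → (V →L[ℝ] ℝ)}
    (hg : ∀ x ∈ E, ∀ y ∈ Ω, |g y - g x - p x (y - x)| ≤ K * ‖y - x‖ ^ 2) :
    ∃ C : NNReal, LipschitzOnWith C p E := by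
  obtain ⟨τ, hτ0, hτ1, hτD⟩ : ∃ τ : ℝ, 0 < τ ∧ τ ≤ 1 ∧ τ * D ≤ ρ := by
    have hpos : 0 < |D| + 1 := by positivity
    refine ⟨min 1 (ρ / (|D| + 1)), by positivity, min_le_left _ _, ?_⟩
    have h1 : min 1 (ρ / (|D| + 1)) ≤ ρ / (|D| + 1) := min_le_right _ _
    have h2 : 0 < min 1 (ρ / (|D| + 1)) := by positivity
    calc min 1 (ρ / (|D| + 1)) * D ≤ min 1 (ρ / (|D| + 1)) * (|D| + 1) := by
          apply mul_le_mul_of_nonneg_left _ h2.le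
          linarith [le_abs_self D]
      _ ≤ ρ / (|D| + 1) * (|D| + 1) := by gcongr
      _ = ρ := by field_simp
  have hC0 : 0 ≤ 6 * K / τ := by positivity
  refine ⟨⟨6 * K / τ, hC0⟩, LipschitzOnWith.of_dist_le_mul ?_⟩
  intro x hx y hy
  rw [dist_eq_norm, dist_eq_norm]
  change ‖p x - p y‖ ≤ (6 * K / τ) * ‖x - y‖
  rcases eq_or_ne x y with rfl | hxy
  · simp
  have hd : 0 < ‖x - y‖ := norm_pos_iff.mpr (sub_ne_zero.mpr hxy)
  -- basic one-sided estimate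
  have key : ∀ v : V, ‖v‖ ≤ τ * ‖x - y‖ → (p x - p y) v ≤ 6 * K * ‖x - y‖ ^ 2 := by
    intro v hv
    have hvd : ‖v‖ ≤ ‖x - y‖ := hv.trans (by nlinarith)
    have hz : y + v ∈ Ω := by
      apply hball y hy
      rw [Metric.mem_closedBall, dist_eq_norm, add_sub_cancel_left]
      calc ‖v‖ ≤ τ * ‖x - y‖ := hv
        _ ≤ τ * D := by gcongr; exact hD x hx y hy
        _ ≤ ρ := hτD
    have hyΩ : y ∈ Ω := hball y hy (Metric.mem_closedBall_self hρ.le)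
    have h1 := abs_le.mp (hg x hx (y + v) hz)
    have h2 := abs_le.mp (hg x hx y hyΩ)
    have h3 := abs_le.mp (hg y hy (y + v) hz)
    have e1 : p x (y + v - x) = p x (y - x) + p x v := by
      rw [← map_add]; congr 1; abel
    have e3 : y + v - y = v := by abel
    rw [e3] at h3
    have n1 : ‖y + v - x‖ ≤ 2 * ‖x - y‖ := by
      calc ‖y + v - x‖ = ‖(y - x) + v‖ := by congr 1; abel
        _ ≤ ‖y - x‖ + ‖v‖ := norm_add_le _ _
        _ ≤ 2 * ‖x - y‖ := by rw [norm_sub_rev]; linarith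
    have n1' : ‖y + v - x‖ ^ 2 ≤ 4 * ‖x - y‖ ^ 2 := by
      calc ‖y + v - x‖ ^ 2 ≤ (2 * ‖x - y‖) ^ 2 := by gcongr
        _ = _ := by ring
    have n3' : ‖v‖ ^ 2 ≤ ‖x - y‖ ^ 2 := by gcongr
    have n2 : ‖y - x‖ = ‖x - y‖ := norm_sub_rev _ _
    rw [n2] at h2
    rw [e1] at h1
    have k1 := mul_le_mul_of_nonneg_left n1' hK
    have k3 := mul_le_mul_of_nonneg_left n3' hK
    have : (p x - p y) v = p x v - p y v := rfl
    rw [this]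
    linarith [h1.1, h1.2, h2.1, h2.2, h3.1, h3.2]
  apply ContinuousLinearMap.opNorm_le_bound _ (by positivity)
  have key2 : ∀ w : V, (p x - p y) w ≤ 6 * K / τ * ‖x - y‖ * ‖w‖ := by
    intro w
    rcases eq_or_ne w 0 with rfl | hw
    · simp
    have hw0 : 0 < ‖w‖ := norm_pos_iff.mpr hw
    have h1 := key ((τ * ‖x - y‖ / ‖w‖) • w) (by
      rw [norm_smul, Real.norm_of_nonneg (by positivity)]
      rw [div_mul_cancel₀ _ hw0.ne'])
    rw [map_smul, smul_eq_mul] at h1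
    have h2 : (p x - p y) w = (‖w‖ / (τ * ‖x - y‖)) * (τ * ‖x - y‖ / ‖w‖ * (p x - p y) w) := by
      field_simp
    rw [h2]
    calc (‖w‖ / (τ * ‖x - y‖)) * (τ * ‖x - y‖ / ‖w‖ * (p x - p y) w)
        ≤ (‖w‖ / (τ * ‖x - y‖)) * (6 * K * ‖x - y‖ ^ 2) := by gcongr
      _ = _ := by field_simp
  intro w
  rw [Real.norm_eq_abs, abs_le]
  constructor
  · have := key2 (-w)
    rw [map_neg, norm_neg] at this
    linarith
  · exact key2 w

variable [FiniteDimensional ℝ V] [MeasurableSpace V] [BorelSpace V]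

/-- At density points of `E`, every nearby point is relatively close to `E`. -/
lemma ae_dense_point (μ : Measure V) [μ.IsAddHaarMeasure] (E : Set V) :
    ∀ᵐ x ∂(μ.restrict E), ∀ k : ℕ, 0 < k → ∃ r₀ > 0, ∀ r, 0 < r → r < r₀ →
      ∀ y, ‖y - x‖ ≤ r → ∃ z ∈ E, ‖z - y‖ ≤ r / k := by
  rw [ae_all_iff]
  intro k
  by_cases hk : 0 < k
  swap
  · filter_upwards with x h; exact absurd h hk
  have hk' : (0:ℝ) < k := by exact_mod_cast hk
  filter_upwards [IsUnifLocDoublingMeasure.ae_tendsto_measure_inter_div μ E (k : ℝ)] with x hx _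
  by_contra hcon
  push Not at hcon
  have hseq : ∀ m : ℕ, ∃ r, 0 < r ∧ r < 1 / ((m : ℝ) + 1) ∧
      ∃ y, ‖y - x‖ ≤ r ∧ ∀ z ∈ E, r / k < ‖z - y‖ := by
    intro m
    obtain ⟨r, h1, h2, h3⟩ := hcon (1 / ((m : ℝ) + 1)) (by positivity)
    exact ⟨r, h1, h2, h3⟩
  choose r hr0 hr1 y hy hz using hseq
  have hrlim : Tendsto r atTop (𝓝 0) :=
    squeeze_zero (fun m => (hr0 m).le) (fun m => (hr1 m).le) tendsto_one_div_add_atTop_nhds_zero_nat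
  have h := @hx ℕ atTop y (fun m => r m / k) (by
    rw [tendsto_nhdsWithin_iff]
    refine ⟨by simpa using hrlim.div_const (k : ℝ), Eventually.of_forall fun m => ?_⟩
    exact div_pos (hr0 m) hk') (Eventually.of_forall fun m => by
      rw [Metric.mem_closedBall, dist_eq_norm, norm_sub_rev, mul_div_cancel₀ _ hk'.ne']
      exact hy m)
  have hempty : ∀ m, E ∩ Metric.closedBall (y m) (r m / k) = ∅ := by
    intro m
    rw [Set.eq_empty_iff_forall_notMem]
    rintro z ⟨hzE, hzb⟩
    rw [Metric.mem_closedBall, dist_eq_norm] at hzb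
    exact absurd hzb (not_le.mpr (hz m z hzE))
  simp only [hempty, measure_empty, ENNReal.zero_div] at h
  exact zero_ne_one (tendsto_nhds_unique tendsto_const_nhds h)

end AbstractJensen

section AbstractJensen2

open MeasureTheory

variable {V : Type*} [NormedAddCommGroup V] [NormedSpace ℝ V]

/-- Second order expansion at a density point where the Lipschitz extension of the slopes is
differentiable. -/
lemma second_order_expansion {Ω E : Set V} (hΩ : IsOpen Ω) {x : V} (hxE : x ∈ E) (hxΩ : x ∈ Ω)
    {K : ℝ} (hK : 0 ≤ K) {g : V → ℝ} {p G : V → (V →L[ℝ] ℝ)}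
    (hg : ∀ z ∈ E, ∀ y ∈ Ω, |g y - g z - p z (y - z)| ≤ K * ‖y - z‖ ^ 2)
    (hG : ∀ z ∈ E, p z = G z) {A : V →L[ℝ] (V →L[ℝ] ℝ)} (hA : HasFDerivAt G A x)
    (hdens : ∀ k : ℕ, 0 < k → ∃ r₀ > 0, ∀ r, 0 < r → r < r₀ →
      ∀ y, ‖y - x‖ ≤ r → ∃ z ∈ E, ‖z - y‖ ≤ r / k)
    {κ : ℝ} (hκ : 0 < κ) :
    ∀ᶠ y in 𝓝 x, |g y - g x - p x (y - x) - (1 / 2) * A (y - x) (y - x)| ≤ κ * ‖y - x‖ ^ 2 := by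
  set B : ℝ := 5 * K + 2 * ‖A‖ with hB
  have hB0 : 0 ≤ B := by positivity
  obtain ⟨m, hm⟩ := exists_nat_gt (2 * B / κ)
  have hm0 : (0:ℝ) < m := lt_of_le_of_lt (by positivity) hm
  have hm0' : 0 < m := by exact_mod_cast hm0
  have hBm : B / m ≤ κ / 2 := by
    rw [div_lt_iff₀ hκ] at hm
    rw [div_le_iff₀ hm0]; linarith
  obtain ⟨r₀, hr₀, hd⟩ := hdens m hm0'
  obtain ⟨r₁, hr₁, hball⟩ := Metric.isOpen_iff.mp hΩ x hxΩ
  have hlit := hA.isLittleO.def (show (0:ℝ) < κ / 4 by positivity)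
  obtain ⟨r₂, hr₂, hlit⟩ := Metric.eventually_nhds_iff.mp hlit
  rw [Metric.eventually_nhds_iff]
  refine ⟨min r₀ (min r₁ (r₂ / 2)), by positivity, ?_⟩
  intro y hy
  rw [dist_eq_norm] at hy
  have hy0 := hy.trans_le (min_le_left _ _)
  have hy1 := (hy.trans_le (min_le_right _ _)).trans_le (min_le_left _ _)
  have hy2 := (hy.trans_le (min_le_right _ _)).trans_le (min_le_right _ _)
  rcases eq_or_ne y x with rfl | hne
  · simp
  set h := y - x with hh
  have hyx : y = x + h := by rw [hh]; abel
  set d := ‖h‖ with hd'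
  have hd0 : 0 < d := norm_pos_iff.mpr (sub_ne_zero.mpr hne)
  have hstep : ∀ i : ℕ, i < m →
      |g (x + (((i:ℝ) + 1) / m) • h) - g (x + ((i:ℝ) / m) • h) - (1 / m) * p x h
        - ((i:ℝ) / m ^ 2) * A h h| ≤ (5 * K + ‖A‖) * d ^ 2 / m ^ 2 + (κ / 2) * d ^ 2 / m := by
    intro i him
    have him' : (i:ℝ) + 1 ≤ m := by exact_mod_cast him
    have hi0 : (0:ℝ) ≤ i := Nat.cast_nonneg i
    set a := x + ((i:ℝ) / m) • h with ha
    set b := x + (((i:ℝ) + 1) / m) • h with hb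
    have hax : a - x = ((i:ℝ) / m) • h := by rw [ha]; abel
    have hbx : b - x = (((i:ℝ) + 1) / m) • h := by rw [hb]; abel
    have hba : b - a = (1 / (m:ℝ)) • h := by
      rw [ha, hb, add_sub_add_left_eq_sub, ← sub_smul]; congr 1; ring
    have nax : ‖a - x‖ ≤ d := by
      rw [hax, norm_smul, Real.norm_of_nonneg (by positivity)]
      have : (i:ℝ) / m ≤ 1 := by rw [div_le_one hm0]; linarith
      nlinarith
    have nbx : ‖b - x‖ ≤ d := by
      rw [hbx, norm_smul, Real.norm_of_nonneg (by positivity)]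
      have : ((i:ℝ) + 1) / m ≤ 1 := by rw [div_le_one hm0]; linarith
      nlinarith
    have nba : ‖b - a‖ = d / m := by
      rw [hba, norm_smul, Real.norm_of_nonneg (by positivity)]; ring
    obtain ⟨z, hzE, hza⟩ := hd d hd0 hy0 a nax
    have haΩ : a ∈ Ω := hball (by rw [Metric.mem_ball, dist_eq_norm]; linarith)
    have hbΩ : b ∈ Ω := hball (by rw [Metric.mem_ball, dist_eq_norm]; linarith)
    have h1 := hg z hzE a haΩ
    have h2 := hg z hzE b hbΩ
    have naz : ‖a - z‖ ≤ d / m := by rw [norm_sub_rev]; exact hza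
    have nbz : ‖b - z‖ ≤ 2 * (d / m) := by
      calc ‖b - z‖ = ‖(b - a) + (a - z)‖ := by congr 1; abel
        _ ≤ ‖b - a‖ + ‖a - z‖ := norm_add_le _ _
        _ ≤ 2 * (d / m) := by linarith
    have naz2 : ‖a - z‖ ^ 2 ≤ (d / m) ^ 2 := by gcongr
    have nbz2 : ‖b - z‖ ^ 2 ≤ (2 * (d / m)) ^ 2 := by gcongr
    have nzx : ‖z - x‖ ≤ 2 * d := by
      have hdm : d / m ≤ d := by
        rw [div_le_iff₀ hm0]
        have : (1:ℝ) ≤ m := by exact_mod_cast hm0'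
        nlinarith
      calc ‖z - x‖ = ‖(z - a) + (a - x)‖ := by congr 1; abel
        _ ≤ ‖z - a‖ + ‖a - x‖ := norm_add_le _ _
        _ ≤ 2 * d := by linarith
    have h3 := @hlit z (by rw [dist_eq_norm]; linarith)
    have h4 : |(G z - G x - A (z - x)) ((1 / (m:ℝ)) • h)| ≤ (κ / 2) * d ^ 2 / m := by
      have := ContinuousLinearMap.le_opNorm (G z - G x - A (z - x)) ((1 / (m:ℝ)) • h)
      rw [Real.norm_eq_abs] at this
      refine this.trans ?_
      rw [norm_smul, Real.norm_of_nonneg (by positivity : (0:ℝ) ≤ 1 / m)]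
      calc ‖G z - G x - A (z - x)‖ * (1 / m * ‖h‖) ≤ (κ / 4 * (2 * d)) * (1 / m * ‖h‖) := by
            gcongr
            exact h3.trans (by gcongr)
        _ = _ := by rw [← hd']; ring
    have h5 : |A (z - a) ((1 / (m:ℝ)) • h)| ≤ ‖A‖ * d ^ 2 / m ^ 2 := by
      have := ContinuousLinearMap.le_opNorm₂ A (z - a) ((1 / (m:ℝ)) • h)
      rw [Real.norm_eq_abs] at this
      refine this.trans ?_
      rw [norm_smul, Real.norm_of_nonneg (by positivity : (0:ℝ) ≤ 1 / m)]
      calc ‖A‖ * ‖z - a‖ * (1 / m * ‖h‖) ≤ ‖A‖ * (d / m) * (1 / m * ‖h‖) := by gcongr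
        _ = _ := by rw [← hd']; ring
    have e1 : p z (b - z) = p z (a - z) + p z ((1 / (m:ℝ)) • h) := by
      rw [← hba, ← map_add]; congr 1; abel
    have e2 : A (z - x) = A (z - a) + ((i:ℝ) / m) • A h := by
      rw [← map_smul, ← hax, ← map_add]; congr 1; abel
    rw [e2, ← hG z hzE, ← hG x hxE] at h4
    simp only [_root_.sub_apply, _root_.add_apply, _root_.smul_apply, map_smul, smul_eq_mul] at h4 h5 e1
    rw [e1] at h2
    have k1 := mul_le_mul_of_nonneg_left naz2 hK
    have k2 := mul_le_mul_of_nonneg_left nbz2 hK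
    have e5 : (i:ℝ) / m ^ 2 * A h h = 1 / m * (i / m * A h h) := by field_simp
    have e6 : (5 * K + ‖A‖) * d ^ 2 / m ^ 2 = K * (d / m) ^ 2 + K * (2 * (d / m)) ^ 2
        + ‖A‖ * d ^ 2 / m ^ 2 := by field_simp; ring
    have e7 : 1 / (m:ℝ) * (i / m * A h h) = i / m * (1 / m * A h h) := by ring
    rw [abs_le] at h1 h2 h4 h5 ⊢
    rw [e5, e6]
    constructor <;> linarith [h1.1, h1.2, h2.1, h2.2, h4.1, h4.2, h5.1, h5.2]
  have hind : ∀ i : ℕ, i ≤ m → |g (x + ((i:ℝ) / m) • h) - g x - ((i:ℝ) / m) * p x h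
        - ((i:ℝ) * (i - 1) / (2 * m ^ 2)) * A h h|
        ≤ i * ((5 * K + ‖A‖) * d ^ 2 / m ^ 2 + (κ / 2) * d ^ 2 / m) := by
    intro i
    induction i with
    | zero => intro _; simp
    | succ i ih =>
      intro hi
      have h1 := ih (by omega)
      have h2 := hstep i (by omega)
      push_cast
      have e1 : ((i:ℝ) + 1) / m * p x h = i / m * p x h + 1 / m * p x h := by ring
      have e2 : ((i:ℝ) + 1) * (i + 1 - 1) / (2 * m ^ 2) * A h h
          = i * (i - 1) / (2 * m ^ 2) * A h h + i / m ^ 2 * A h h := by field_simp; ring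
      rw [e1, e2, add_mul (i:ℝ) 1, one_mul]
      rw [abs_le] at h1 h2 ⊢
      constructor <;> linarith [h1.1, h1.2, h2.1, h2.2]
  have hfin := hind m le_rfl
  rw [div_self hm0.ne', one_smul, ← hyx, one_mul] at hfin
  have hAh : |A h h| ≤ ‖A‖ * d ^ 2 := by
    have := ContinuousLinearMap.le_opNorm₂ A h h
    rw [Real.norm_eq_abs] at this
    calc |A h h| ≤ ‖A‖ * ‖h‖ * ‖h‖ := this
      _ = _ := by rw [← hd']; ring
  have e1 : (m:ℝ) * (m - 1) / (2 * m ^ 2) * A h h = 1 / 2 * A h h - 1 / (2 * m) * A h h := by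
    field_simp
  have e2 : (m:ℝ) * ((5 * K + ‖A‖) * d ^ 2 / m ^ 2 + (κ / 2) * d ^ 2 / m)
      = (5 * K + ‖A‖) * d ^ 2 / m + (κ / 2) * d ^ 2 := by field_simp
  rw [e1, e2] at hfin
  have h6 : |1 / (2 * (m:ℝ)) * A h h| ≤ ‖A‖ * d ^ 2 / m := by
    rw [abs_mul, abs_of_nonneg (by positivity : (0:ℝ) ≤ 1 / (2 * m))]
    calc 1 / (2 * (m:ℝ)) * |A h h| ≤ 1 / (2 * (m:ℝ)) * (‖A‖ * d ^ 2) := by gcongr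
      _ = (‖A‖ * d ^ 2 / m) / 2 := by field_simp
      _ ≤ _ := half_le_self (by positivity)
  have h7 : (5 * K + ‖A‖) * d ^ 2 / m + ‖A‖ * d ^ 2 / m = B / m * d ^ 2 := by
    rw [hB]; ring
  have h8 : B / m * d ^ 2 ≤ κ / 2 * d ^ 2 := by gcongr
  rw [abs_le] at hfin h6 ⊢
  constructor <;> linarith [hfin.1, hfin.2, h6.1, h6.2]

variable [FiniteDimensional ℝ V]

/-- Jensen's lemma combined with Alexandrov's theorem, on the contact set. -/
lemma jensen_alexandrov {Ω E : Set V} (hΩ : IsOpen Ω) {ρ D K r : ℝ} (hρ : 0 < ρ) (hK : 0 ≤ K)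
    (hr : 0 < r)
    (hball : ∀ x ∈ E, Metric.closedBall x ρ ⊆ Ω) (hD : ∀ x ∈ E, ∀ y ∈ E, ‖x - y‖ ≤ D)
    {Φ u : V → ℝ}
    (hsurj : ∀ ℓ : V →L[ℝ] ℝ, ‖ℓ‖ ≤ r → ∃ x ∈ E, ∀ y ∈ Ω, Φ y ≤ Φ x + ℓ (y - x))
    (hEup : ∀ x ∈ E, ∃ ℓ : V →L[ℝ] ℝ, ∀ y ∈ Ω, Φ y ≤ Φ x + ℓ (y - x))
    (hΦlow : ∀ x ∈ E, ∃ p : V →L[ℝ] ℝ, ∀ y ∈ Ω, Φ x + p (y - x) - K * ‖y - x‖ ^ 2 ≤ Φ y)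
    (hu : ∀ x ∈ E, ∃ p : V →L[ℝ] ℝ, ∀ y ∈ Ω, |u y - u x - p (y - x)| ≤ K * ‖y - x‖ ^ 2) :
    ∃ x ∈ E, ∃ p : V →L[ℝ] ℝ, ∃ A : V →L[ℝ] (V →L[ℝ] ℝ), ∀ κ > 0, ∀ᶠ y in 𝓝 x,
      |u y - u x - p (y - x) - (1 / 2) * A (y - x) (y - x)| ≤ κ * ‖y - x‖ ^ 2 := by
  classical
  have hEΩ : ∀ x ∈ E, x ∈ Ω := fun x hx => hball x hx (Metric.mem_closedBall_self hρ.le)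
  borelize V
  borelize (V →L[ℝ] ℝ)
  have hfr : Module.finrank ℝ (V →L[ℝ] ℝ) = Module.finrank ℝ V := by
    rw [← LinearEquiv.finrank_eq (LinearMap.toContinuousLinearMap : (V →ₗ[ℝ] ℝ) ≃ₗ[ℝ] (V →L[ℝ] ℝ))]
    exact Subspace.dual_finrank_eq
  -- the slopes of Φ
  choose! ℓ hℓ using hEup
  have hΦ2 : ∀ x ∈ E, ∀ y ∈ Ω, |Φ y - Φ x - ℓ x (y - x)| ≤ K * ‖y - x‖ ^ 2 := by
    intro x hx y hy
    obtain ⟨p, hp⟩ := hΦlow x hx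
    have hpl : p = ℓ x := slope_unique (K := K) hΩ (hEΩ x hx) (fun y hy => by
      linarith [hp y hy, hℓ x hx y hy])
    have h1 := hp y hy
    have h2 := hℓ x hx y hy
    rw [hpl] at h1
    rw [abs_le]
    have : 0 ≤ K * ‖y - x‖ ^ 2 := by positivity
    constructor <;> linarith
  obtain ⟨C, hC⟩ := slope_lipschitz hρ hK hball hD hΦ2
  have himg : Metric.closedBall (0 : V →L[ℝ] ℝ) r ⊆ ℓ '' E := by
    intro q hq
    obtain ⟨x, hx, hmax⟩ := hsurj q (by simpa using hq)
    refine ⟨x, hx, ?_⟩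
    symm
    have hneg : ∀ y ∈ Ω, ℓ x (y - x) ≤ q (y - x) + K * ‖y - x‖ ^ 2 := by
      intro y hy
      have h1 := hmax y hy
      have h2 := (abs_le.mp (hΦ2 x hx y hy)).1
      linarith
    exact (slope_unique hΩ (hEΩ x hx) hneg).symm
  have hμE : (μH[Module.finrank ℝ V] : Measure V) E ≠ 0 := by
    intro h0
    have h1 := hC.hausdorffMeasure_image_le (d := (Module.finrank ℝ V : ℝ)) (Nat.cast_nonneg _)
    rw [h0, mul_zero] at h1
    have h2 : (μH[Module.finrank ℝ (V →L[ℝ] ℝ)] : Measure (V →L[ℝ] ℝ))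
        (Metric.closedBall 0 r) = 0 := by
      rw [hfr]
      exact le_antisymm ((measure_mono himg).trans h1) (zero_le)
    exact (Metric.measure_closedBall_pos _ (0 : V →L[ℝ] ℝ) hr).ne' h2
  -- the slopes of u
  choose! p hp using hu
  obtain ⟨C', hC'⟩ := slope_lipschitz hρ hK hball hD hp
  obtain ⟨G, hGlip, hG⟩ := hC'.extend_finite_dimension
  have hdiff : ∀ᵐ x ∂((μH[Module.finrank ℝ V] : Measure V).restrict E), DifferentiableAt ℝ G x :=
    ae_restrict_of_ae hGlip.ae_differentiableAt
  have hdens := ae_dense_point (μH[Module.finrank ℝ V] : Measure V) E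
  obtain ⟨x, hxE, hx1, hx2⟩ : ∃ x ∈ E, DifferentiableAt ℝ G x ∧ ∀ k : ℕ, 0 < k →
      ∃ r₀ > 0, ∀ r, 0 < r → r < r₀ → ∀ y, ‖y - x‖ ≤ r → ∃ z ∈ E, ‖z - y‖ ≤ r / k := by
    by_contra hcon
    push Not at hcon
    have hboth := hdiff.and hdens
    rw [ae_iff] at hboth
    apply hμE
    refine le_antisymm (le_trans ?_ ((Measure.le_restrict_apply E _).trans hboth.le)) zero_le
    apply measure_mono
    intro x hx
    refine ⟨?_, hx⟩
    rintro ⟨h1, h2⟩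
    obtain ⟨k, hk, h3⟩ := hcon x hx h1
    obtain ⟨r₀, hr₀, h4⟩ := h2 k hk
    obtain ⟨r', h5, h6, y, h7, h8⟩ := h3 r₀ hr₀
    obtain ⟨z, hz, h9⟩ := h4 r' h5 h6 y h7
    exact absurd h9 (not_le.mpr (h8 z hz))
  exact ⟨x, hxE, p x, fderiv ℝ G x, fun κ hκ =>
    second_order_expansion hΩ hxE (hEΩ x hxE) hK hp hG hx1.hasFDerivAt hx2 hκ⟩

end AbstractJensen2

section MatrixPart

lemma scal_a {a K t σ s P Q : ℝ} (ht : 0 < t) (ht2 : t ≤ 1 / 2) (hs : s = 1 ∨ s = -1)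
    (hσ : σ = 1 + s * t) (hK : 4 * |a| ≤ K) :
    -(3 * |a| * Q ^ 2) ≤ t * (K * t * P ^ 2 + a * (σ * P + Q) ^ 2 - σ * (a * P ^ 2)) := by
  have h0 : 0 ≤ |a| := abs_nonneg a
  have hX : 0 ≤ (K - 4 * |a|) * (t * P) ^ 2 := mul_nonneg (by linarith) (sq_nonneg _)
  have e : t * (K * t * P ^ 2 + a * (σ * P + Q) ^ 2 - σ * (a * P ^ 2)) =
      (K - 4 * |a|) * (t * P) ^ 2 + 4 * |a| * (t * P) ^ 2
      + a * (s * σ * (t * P) ^ 2 + 2 * σ * (t * P) * Q + t * Q ^ 2) := by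
    subst hσ; ring
  have hb : -(4 * (t * P) ^ 2 + 3 * Q ^ 2) ≤
        (s * σ * (t * P) ^ 2 + 2 * σ * (t * P) * Q + t * Q ^ 2) ∧
      (s * σ * (t * P) ^ 2 + 2 * σ * (t * P) * Q + t * Q ^ 2) ≤ 4 * (t * P) ^ 2 + 3 * Q ^ 2 := by
    generalize t * P = X
    have hσ1 : 1 / 2 ≤ σ ∧ σ ≤ 3 / 2 := by
      rcases hs with rfl | rfl <;> constructor <;> linarith
    have k1 : 0 ≤ (3 / 2 - σ) * X ^ 2 := mul_nonneg (by linarith) (sq_nonneg _)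
    have k2 : 0 ≤ (1 / 2 - t) * Q ^ 2 := mul_nonneg (by linarith) (sq_nonneg _)
    have k3 : 0 ≤ t * Q ^ 2 := by positivity
    have k4 : 0 ≤ σ * (X + Q) ^ 2 := mul_nonneg (by linarith) (sq_nonneg _)
    have k5 : 0 ≤ σ * (X - Q) ^ 2 := mul_nonneg (by linarith) (sq_nonneg _)
    have k6 : 0 ≤ (3 / 2 - σ) * Q ^ 2 := mul_nonneg (by linarith) (sq_nonneg _)
    have k7 : 0 ≤ σ * X ^ 2 := mul_nonneg (by linarith) (sq_nonneg _)
    have k8 := sq_nonneg X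
    have k9 := sq_nonneg Q
    rcases hs with rfl | rfl <;> constructor <;> nlinarith
  rw [e]
  generalize t * P = X at *
  generalize (s * σ * X ^ 2 + 2 * σ * X * Q + t * Q ^ 2) = Y at *
  have h1 : |a * Y| ≤ |a| * (4 * X ^ 2 + 3 * Q ^ 2) := by
    rw [abs_mul]
    exact mul_le_mul_of_nonneg_left (abs_le.mpr hb) h0
  have h2 := neg_abs_le (a * Y)
  linarith

lemma scal_c {c t σ s X Y Z : ℝ} (hs : s = 1 ∨ s = -1)
    (ht : 0 < t) (ht2 : t ≤ 1 / 2) (hY : 0 ≤ Y)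
    (hσ : σ = 1 + s * t) (hc : s * c ≤ 0) (hpos : 0 ≤ t ^ 2 * X + 2 * s * t * Z + Y) :
    -(2 * |c| * Y) ≤ t * (-(c * (σ ^ 2 * X + 2 * σ * Z + Y)) + σ * (c * X)) := by
  have hσ1 : 1 / 2 ≤ σ ∧ σ ≤ 3 / 2 := by
    rcases hs with rfl | rfl <;> constructor <;> linarith
  have hc' : |c| = -(s * c) := by
    rcases hs with rfl | rfl
    · rw [abs_of_nonpos (by linarith)]; ring
    · rw [abs_of_nonneg (by linarith)]; ring
  have hss : s * s = 1 := by rcases hs with rfl | rfl <;> norm_num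
  have e : t * (-(c * (σ ^ 2 * X + 2 * σ * Z + Y)) + σ * (c * X)) + 2 * |c| * Y =
      |c| * (σ * (t ^ 2 * X + 2 * s * t * Z + Y) + Y) := by
    rw [hc', hσ]
    rcases hs with rfl | rfl <;> ring
  have : 0 ≤ |c| * (σ * (t ^ 2 * X + 2 * s * t * Z + Y) + Y) := by
    have : 0 ≤ σ := by linarith
    positivity
  linarith

variable {n : ℕ}

lemma dot_vecMulVec (p v : HIdx n → ℝ) :
    v ⬝ᵥ (vecMulVec p p *ᵥ v) = (p ⬝ᵥ v) ^ 2 := by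
  rw [vecMulVec_mulVec, dotProduct_smul, dotProduct_comm v p]
  simp [sq]

lemma Jmat_dot_self (q : HIdx n → ℝ) :
    (Jmat n *ᵥ q) ⬝ᵥ (Jmat n *ᵥ q) = q ⬝ᵥ q := by
  have h : ∀ i, (Jmat n *ᵥ q) i = match i with
      | Sum.inl a => q (Sum.inr a)
      | Sum.inr a => - q (Sum.inl a) := by
    rintro (i | i) <;> simp [Jmat, mulVec, dotProduct, Fintype.sum_sum_type]
  simp only [dotProduct, Fintype.sum_sum_type, h]
  rw [add_comm]
  congr 1
  apply Finset.sum_congr rfl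
  intro i _
  ring

lemma dot_sq_le (p v : HIdx n → ℝ) : (p ⬝ᵥ v) ^ 2 ≤ (p ⬝ᵥ p) * (v ⬝ᵥ v) := by
  have := Finset.sum_mul_sq_le_sq_mul_sq Finset.univ p v
  simpa [dotProduct, sq] using this

lemma dot_self_nonneg (p : HIdx n → ℝ) : 0 ≤ p ⬝ᵥ p :=
  Finset.sum_nonneg fun i _ => mul_self_nonneg (p i)

lemma LquadC_quad (a b c : ℝ) (ξ : Heis n) (s : ℝ) (p v : HIdx n → ℝ) :
    v ⬝ᵥ (LquadC a b c ξ s p *ᵥ v) =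
      a * (p ⬝ᵥ v) ^ 2 - c * ((Jmat n *ᵥ p) ⬝ᵥ v) ^ 2 - b * (p ⬝ᵥ p) * (v ⬝ᵥ v) := by
  simp only [LquadC, sub_mulVec, smul_mulVec, one_mulVec, dotProduct_sub, dotProduct_smul,
    dot_vecMulVec, smul_eq_mul]
  congr 2
  simp [dotProduct, sq]

lemma LquadC_symm (a b c : ℝ) (ξ : Heis n) (s : ℝ) (p : HIdx n → ℝ) :
    (LquadC a b c ξ s p).IsSymm := by
  have h1 : ∀ w : HIdx n → ℝ, (vecMulVec w w).IsSymm := by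
    intro w; ext i j; simp [vecMulVec_apply, mul_comm]
  unfold LquadC
  exact (((h1 _).smul _).sub ((h1 _).smul _)).sub (isSymm_one.smul _)

/-- The key matrix inequality behind the strict subsolution construction. -/
lemma key_matrix {a b c K t σ s ε : ℝ} (ht : 0 < t) (ht2 : t ≤ 1 / 2) (hs : s = 1 ∨ s = -1)
    (hσ : σ = 1 + s * t) (hK : 4 * |a| ≤ K) (hb : s * b ≤ 0) (hc : s * c ≤ 0)
    (ξ ξ' : Heis n) (s1 s2 : ℝ) (p q v : HIdx n → ℝ)
    (hq : (q ⬝ᵥ q) * (3 * (|a| + |b| + |c|)) ≤ ε * t) :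
    ε * (v ⬝ᵥ v) ≤ v ⬝ᵥ ((((2 * ε) • (1 : HMat n) + (K * t) • vecMulVec p p)
      + LquadC a b c ξ s1 (σ • p + q) - σ • LquadC a b c ξ' s2 p) *ᵥ v) := by
  simp only [sub_mulVec, add_mulVec, smul_mulVec, one_mulVec, dotProduct_sub, dotProduct_add,
    dotProduct_smul, dot_vecMulVec, smul_eq_mul, LquadC_quad, mulVec_add, mulVec_smul,
    add_dotProduct, smul_dotProduct]
  have hQ := dot_sq_le q v
  have hJQ := dot_sq_le (Jmat n *ᵥ q) v
  rw [Jmat_dot_self] at hJQ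
  have hpq : 0 ≤ t ^ 2 * (p ⬝ᵥ p) + 2 * s * t * (p ⬝ᵥ q) + q ⬝ᵥ q := by
    have := dot_self_nonneg (t • p + s • q)
    simp only [dotProduct_add, add_dotProduct, smul_dotProduct, dotProduct_smul, smul_eq_mul] at this
    rw [dotProduct_comm q p] at this
    have hss : s * s = 1 := by rcases hs with rfl | rfl <;> norm_num
    calc (0:ℝ) ≤ _ := this
      _ = t ^ 2 * (p ⬝ᵥ p) + 2 * s * t * (p ⬝ᵥ q) + (s * s) * (q ⬝ᵥ q) := by ring
      _ = _ := by rw [hss, one_mul]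
  rw [dotProduct_comm q p]
  have hvv := dot_self_nonneg v
  have hqq := dot_self_nonneg q
  generalize p ⬝ᵥ v = P at *
  generalize q ⬝ᵥ v = Q at *
  generalize (Jmat n *ᵥ p) ⬝ᵥ v = JP at *
  generalize (Jmat n *ᵥ q) ⬝ᵥ v = JQ at *
  generalize p ⬝ᵥ p = pp at *
  generalize q ⬝ᵥ q = qq at *
  generalize p ⬝ᵥ q = pq at *
  generalize v ⬝ᵥ v = vv at *
  have h1 := scal_a (P := P) (Q := Q) ht ht2 hs hσ hK
  have hss : s ^ 2 = 1 := by rcases hs with rfl | rfl <;> norm_num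
  have h2 := scal_c (X := JP ^ 2) (Y := JQ ^ 2) (Z := JP * JQ) hs ht ht2 (sq_nonneg _) hσ hc (by
    have := sq_nonneg (t * JP + s * JQ)
    calc (0:ℝ) ≤ _ := this
      _ = t ^ 2 * JP ^ 2 + 2 * s * t * (JP * JQ) + s ^ 2 * JQ ^ 2 := by ring
      _ = _ := by rw [hss, one_mul])
  have h3 := mul_le_mul_of_nonneg_right (scal_c hs ht ht2 hqq hσ hb hpq) hvv
  have k1 := mul_le_mul_of_nonneg_left hQ (abs_nonneg a)
  have k2 := mul_le_mul_of_nonneg_left hJQ (abs_nonneg c)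
  have k3 := mul_le_mul_of_nonneg_right hq hvv
  have k4 : 0 ≤ |c| * (qq * vv) := by positivity
  have k5 : 0 ≤ |b| * (qq * vv) := by positivity
  refine le_of_mul_le_mul_left ?_ ht
  linarith

lemma quad_bound (Q : HMat n) (v : HIdx n → ℝ) :
    |v ⬝ᵥ (Q *ᵥ v)| ≤ (∑ i, ∑ j, |Q i j|) * (v ⬝ᵥ v) := by
  have hv : ∀ i j, |v i| * |v j| ≤ v ⬝ᵥ v := by
    intro i j
    have hi : ∀ i, |v i| ^ 2 ≤ v ⬝ᵥ v := by
      intro i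
      rw [sq_abs, sq]
      exact Finset.single_le_sum (f := fun i => v i * v i) (fun i _ => mul_self_nonneg _)
        (Finset.mem_univ i)
    nlinarith [hi i, hi j, sq_nonneg (|v i| - |v j|)]
  simp only [dotProduct, mulVec, Finset.mul_sum]
  calc |∑ i, ∑ j, v i * (Q i j * v j)| ≤ ∑ i, ∑ j, |v i * (Q i j * v j)| :=
        (Finset.abs_sum_le_sum_abs _ _).trans
          (Finset.sum_le_sum fun i _ => Finset.abs_sum_le_sum_abs _ _)
    _ ≤ ∑ i, ∑ j, |Q i j| * (v ⬝ᵥ v) := by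
        gcongr with i _ j _
        rw [abs_mul, abs_mul]
        calc |v i| * (|Q i j| * |v j|) = |Q i j| * (|v i| * |v j|) := by ring
          _ ≤ _ := by gcongr; exact hv i j
    _ = (∑ i, ∑ j, |Q i j|) * (v ⬝ᵥ v) := by simp only [Finset.sum_mul]
    _ = _ := by simp only [dotProduct, Finset.mul_sum]

lemma closure_add_mem {S : Set (HMat n)} (hSsymm : ∀ A ∈ S, A.IsSymm)
    (hSpos : ∀ A ∈ S, ∀ B : HMat n, B.PosDef → A + B ∈ S)
    {A B : HMat n} (hA : A ∈ closure S) (hB : B.IsSymm) {ε : ℝ} (hε : 0 < ε)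
    (hBε : ∀ v : HIdx n → ℝ, ε * (v ⬝ᵥ v) ≤ v ⬝ᵥ (B *ᵥ v)) : A + B ∈ S := by
  have hAs : A.IsSymm := by
    have : IsClosed {M : HMat n | M.IsSymm} := by
      have : {M : HMat n | M.IsSymm} = {M : HMat n | Mᵀ = M} := rfl
      rw [this]
      exact isClosed_eq (continuous_id.matrix_transpose) continuous_id
    exact closure_minimal (fun M hM => hSsymm M hM) this hA
  have hcont : Continuous (fun M : HMat n => ∑ i, ∑ j, |(A - M) i j|) := by
    have h1 : ∀ i j, Continuous (fun M : HMat n => (A - M) i j) := fun i j =>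
      (continuous_const.sub continuous_id).matrix_elem i j
    exact continuous_finsetSum _ fun i _ => continuous_finsetSum _ fun j _ => (h1 i j).abs
  have hopen : IsOpen {M : HMat n | ∑ i, ∑ j, |(A - M) i j| < ε} :=
    isOpen_lt hcont continuous_const
  obtain ⟨M, hM, hMS⟩ := mem_closure_iff.mp hA _ hopen (by simpa using hε)
  have e : A + B = M + (B + (A - M)) := by abel
  rw [e]
  apply hSpos M hMS
  refine Matrix.PosDef.of_dotProduct_mulVec_pos ?_ ?_
  · have := hB.add (hAs.sub (hSsymm M hMS))
    rw [Matrix.IsHermitian, conjTranspose_eq_transpose_of_trivial]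
    exact this
  · intro v hv
    have hv0 : 0 < v ⬝ᵥ v := by
      refine lt_of_le_of_ne (dot_self_nonneg v) (fun h => hv ?_)
      exact dotProduct_self_eq_zero.mp h.symm
    have h1 := hBε v
    have h2 := neg_le_of_abs_le (quad_bound (A - M) v)
    have h3 : (∑ i, ∑ j, |(A - M) i j|) * (v ⬝ᵥ v) < ε * (v ⬝ᵥ v) :=
      mul_lt_mul_of_pos_right hM hv0
    rw [star_trivial, add_mulVec, dotProduct_add]
    linarith

end MatrixPart

section HeisCalculus

variable {n : ℕ}

/-- Linear part of left translation by `a`. -/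
def hlin (a : Heis n) : Heis n →L[ℝ] Heis n :=
  LinearMap.toContinuousLinearMap
    { toFun := fun ξ => (ξ.1, ξ.2.1, ξ.2.2 + 2 * ∑ i, (a.2.1 i * ξ.1 i - a.1 i * ξ.2.1 i))
      map_add' := by
        intro ξ η
        ext i
        · simp
        · simp
        · simp only [Prod.fst_add, Prod.snd_add, Pi.add_apply, Finset.mul_sum]
          have : ∀ i, 2 * (a.2.1 i * (ξ.1 i + η.1 i) - a.1 i * (ξ.2.1 i + η.2.1 i)) =
            2 * (a.2.1 i * ξ.1 i - a.1 i * ξ.2.1 i) + 2 * (a.2.1 i * η.1 i - a.1 i * η.2.1 i) := by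
            intro i; ring
          simp only [this, Finset.sum_add_distrib]
          ring
      map_smul' := by
        intro r ξ
        ext i
        · simp
        · simp
        · simp only [Prod.smul_fst, Prod.smul_snd, Pi.smul_apply, smul_eq_mul, RingHom.id_apply,
            Finset.mul_sum, mul_add]
          congr 1
          apply Finset.sum_congr rfl
          intro i _
          ring }

lemma hlin_apply (a ξ : Heis n) :
    hlin a ξ = (ξ.1, ξ.2.1, ξ.2.2 + 2 * ∑ i, (a.2.1 i * ξ.1 i - a.1 i * ξ.2.1 i)) := rfl

lemma hmul_eq (a ξ : Heis n) : hmul a ξ = a + hlin a ξ := by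
  rw [hlin_apply]
  ext i
  · simp [hmul]
  · simp [hmul]
  · simp [hmul]; ring

lemma hmul_assoc (a b c : Heis n) : hmul (hmul a b) c = hmul a (hmul b c) := by
  ext i
  · simp [hmul, add_assoc]
  · simp [hmul, add_assoc]
  · simp only [hmul, Pi.add_apply, Finset.mul_sum]
    have e : ∀ i, 2 * ((a.2.1 i + b.2.1 i) * c.1 i - (a.1 i + b.1 i) * c.2.1 i)
        + 2 * (a.2.1 i * b.1 i - a.1 i * b.2.1 i) =
        2 * (b.2.1 i * c.1 i - b.1 i * c.2.1 i) +
        2 * (a.2.1 i * (b.1 i + c.1 i) - a.1 i * (b.2.1 i + c.2.1 i)) := by intro i; ring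
    have := Finset.sum_congr (rfl : Finset.univ = Finset.univ) (fun i _ => e i)
    rw [Finset.sum_add_distrib, Finset.sum_add_distrib] at this
    linarith

lemma hmul_hinv (a : Heis n) : hmul a (hinv a) = 0 := by
  ext i
  · simp [hmul, hinv]
  · simp [hmul, hinv]
  · simp [hmul, hinv, mul_comm]

lemma hinv_hmul (a : Heis n) : hmul (hinv a) a = 0 := by
  ext i
  · simp [hmul, hinv]
  · simp [hmul, hinv]
  · simp [hmul, hinv, mul_comm]

lemma zero_hmul' (a : Heis n) : hmul 0 a = a := by
  ext i <;> simp [hmul]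

lemma hmul_zero' (a : Heis n) : hmul a 0 = a := by
  ext i <;> simp [hmul]

lemma hinv_hmul_rev (a b : Heis n) : hinv (hmul a b) = hmul (hinv b) (hinv a) := by
  ext i
  · simp [hmul, hinv, add_comm]
  · simp [hmul, hinv, add_comm]
  · simp only [hmul, hinv, Pi.neg_apply, Finset.mul_sum]
    have e : ∀ i, 2 * (-b.2.1 i * -a.1 i - -b.1 i * -a.2.1 i) =
      -(2 * (a.2.1 i * b.1 i - a.1 i * b.2.1 i)) := by intro i; ring
    simp only [e, Finset.sum_neg_distrib]
    ring

lemma hinv_hinv' (a : Heis n) : hinv (hinv a) = a := by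
  ext i <;> simp [hinv]

lemma hlin_vecField (a ξ : Heis n) (j : HIdx n) :
    hlin a (vecField j ξ) = vecField j (hmul a ξ) := by
  rw [hlin_apply]
  rcases j with j | j
  · ext i
    · simp [vecField]
    · simp [vecField]
    · simp [vecField, hmul, Pi.single_apply]; ring
  · ext i
    · simp [vecField]
    · simp [vecField]
    · simp [vecField, hmul, Pi.single_apply]; ring

lemma hasFDerivAt_hmul (a ξ : Heis n) : HasFDerivAt (hmul a) (hlin a) ξ := by
  have : hmul a = fun ξ => a + hlin a ξ := funext (hmul_eq a)
  rw [this]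
  exact (hlin a).hasFDerivAt.const_add a

lemma contDiff_hmul (a : Heis n) : ContDiff ℝ 2 (hmul a) := by
  have : hmul a = fun ξ => a + hlin a ξ := funext (hmul_eq a)
  rw [this]
  exact contDiff_const.add (hlin a).contDiff

/-- Derivative of `g` along the `j`-th horizontal vector field. -/
def Vd (j : HIdx n) (g : Heis n → ℝ) : Heis n → ℝ := fun η => fderiv ℝ g η (vecField j η)

lemma hGrad_eq (g : Heis n → ℝ) (ξ : Heis n) (j : HIdx n) : hGrad g ξ j = Vd j g ξ := rfl

lemma hHess_eq (g : Heis n → ℝ) (ξ : Heis n) (i j : HIdx n) :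
    hHess g ξ i j = Vd j (Vd i g) ξ := rfl

lemma contDiff_vecField (j : HIdx n) : ContDiff ℝ 2 (vecField j : Heis n → Heis n) := by
  rcases j with j | j
  · have : (vecField (Sum.inl j) : Heis n → Heis n) =
      fun ξ => (Pi.single j 1, 0, 2 * ξ.2.1 j) := rfl
    rw [this]
    fun_prop
  · have : (vecField (Sum.inr j) : Heis n → Heis n) =
      fun ξ => (0, Pi.single j 1, -(2 * ξ.1 j)) := rfl
    rw [this]
    fun_prop

lemma Vd_contDiff {g : Heis n → ℝ} (hg : ContDiff ℝ 2 g) (j : HIdx n) : ContDiff ℝ 1 (Vd j g) := by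
  have h1 : ContDiff ℝ 1 (fderiv ℝ g) := hg.fderiv_right (by norm_num)
  exact h1.clm_apply ((contDiff_vecField j).of_le (by norm_num))

lemma Vd_comp_hmul {g : Heis n → ℝ} (hg : Differentiable ℝ g) (a : Heis n) (j : HIdx n) :
    Vd j (fun ξ => g (hmul a ξ)) = fun ξ => Vd j g (hmul a ξ) := by
  ext ξ
  have h := (hg (hmul a ξ)).hasFDerivAt.comp ξ (hasFDerivAt_hmul a ξ)
  have h' : fderiv ℝ (fun ξ => g (hmul a ξ)) ξ = (fderiv ℝ g (hmul a ξ)).comp (hlin a) := h.fderiv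
  simp only [Vd, h', ContinuousLinearMap.comp_apply, hlin_vecField]

lemma Vd_add_const (g : Heis n → ℝ) (k : ℝ) (j : HIdx n) :
    Vd j (fun ξ => g ξ + k) = Vd j g := by
  ext ξ
  simp [Vd]

/-- Left invariance of the operator. -/
lemma Fop_comp_hmul {g : Heis n → ℝ} (hg : ContDiff ℝ 2 g) (ζ : Heis n) (k α β γ : ℝ)
    (ξ : Heis n) :
    Fop (LquadC α β γ) (fun η => g (hmul ζ η) + k) ξ = Fop (LquadC α β γ) g (hmul ζ ξ) := by
  have hd : Differentiable ℝ g := hg.differentiable (by norm_num)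
  have hG : hGrad (fun η => g (hmul ζ η) + k) ξ = hGrad g (hmul ζ ξ) := by
    ext j
    rw [hGrad_eq, Vd_add_const, Vd_comp_hmul hd]; rfl
  have hH : hHess (fun η => g (hmul ζ η) + k) ξ = hHess g (hmul ζ ξ) := by
    ext i j
    rw [hHess_eq, Vd_add_const, Vd_comp_hmul hd,
      Vd_comp_hmul ((Vd_contDiff hg i).differentiable (by norm_num))]; rfl
  simp only [Fop, hHessSym, hG, hH, LquadC]

lemma Vd_add {g₁ g₂ : Heis n → ℝ} (h₁ : Differentiable ℝ g₁) (h₂ : Differentiable ℝ g₂)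
    (j : HIdx n) : Vd j (fun ξ => g₁ ξ + g₂ ξ) = fun ξ => Vd j g₁ ξ + Vd j g₂ ξ := by
  ext ξ
  simp only [Vd]
  rw [fderiv_fun_add (h₁ ξ) (h₂ ξ)]; rfl

lemma Vd_const_mul {g : Heis n → ℝ} (h : Differentiable ℝ g) (k : ℝ)
    (j : HIdx n) : Vd j (fun ξ => k * g ξ) = fun ξ => k * Vd j g ξ := by
  ext ξ
  simp only [Vd]
  rw [fderiv_const_mul (h ξ) k]; rfl

lemma Vd_mul {g₁ g₂ : Heis n → ℝ} (h₁ : Differentiable ℝ g₁) (h₂ : Differentiable ℝ g₂)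
    (j : HIdx n) : Vd j (fun ξ => g₁ ξ * g₂ ξ) = fun ξ => g₁ ξ * Vd j g₂ ξ + g₂ ξ * Vd j g₁ ξ := by
  ext ξ
  simp only [Vd]
  rw [fderiv_fun_mul (h₁ ξ) (h₂ ξ)]; rfl

lemma Vd_comp {g : Heis n → ℝ} (h : Differentiable ℝ g) {f f' : ℝ → ℝ}
    (hf : ∀ s, HasDerivAt f (f' s) s) (j : HIdx n) :
    Vd j (fun ξ => f (g ξ)) = fun ξ => f' (g ξ) * Vd j g ξ := by
  ext ξ
  have := (hf (g ξ)).comp_hasFDerivAt ξ (h ξ).hasFDerivAt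
  have h' : fderiv ℝ (fun ξ => f (g ξ)) ξ = f' (g ξ) • fderiv ℝ g ξ := this.fderiv
  simp only [Vd, h']; rfl

lemma hHessSym_add {g₁ g₂ : Heis n → ℝ} (h₁ : ContDiff ℝ 2 g₁) (h₂ : ContDiff ℝ 2 g₂)
    (ξ : Heis n) : hHessSym (fun ξ => g₁ ξ + g₂ ξ) ξ = hHessSym g₁ ξ + hHessSym g₂ ξ := by
  have : hHess (fun ξ => g₁ ξ + g₂ ξ) ξ = hHess g₁ ξ + hHess g₂ ξ := by
    ext i j
    rw [Matrix.add_apply, hHess_eq, hHess_eq, hHess_eq, Vd_add (h₁.differentiable (by norm_num))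
      (h₂.differentiable (by norm_num)), Vd_add ((Vd_contDiff h₁ i).differentiable (by norm_num))
      ((Vd_contDiff h₂ i).differentiable (by norm_num))]
  simp only [hHessSym, this, transpose_add, ← smul_add]
  congr 1
  abel

lemma hHessSym_const_mul {g : Heis n → ℝ} (h : ContDiff ℝ 2 g) (k : ℝ)
    (ξ : Heis n) : hHessSym (fun ξ => k * g ξ) ξ = k • hHessSym g ξ := by
  have : hHess (fun ξ => k * g ξ) ξ = k • hHess g ξ := by
    ext i j
    rw [Matrix.smul_apply, hHess_eq, hHess_eq, Vd_const_mul (h.differentiable (by norm_num)),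
      Vd_const_mul ((Vd_contDiff h i).differentiable (by norm_num))]; rfl
  simp only [hHessSym, this, transpose_smul, ← smul_add]
  rw [smul_comm]

lemma hHessSym_comp {g : Heis n → ℝ} (h : ContDiff ℝ 2 g) {f f' f'' : ℝ → ℝ}
    (hf : ∀ s, HasDerivAt f (f' s) s) (hf' : ∀ s, HasDerivAt f' (f'' s) s) (ξ : Heis n) :
    hHessSym (fun ξ => f (g ξ)) ξ =
      f' (g ξ) • hHessSym g ξ + f'' (g ξ) • vecMulVec (hGrad g ξ) (hGrad g ξ) := by
  have hd : Differentiable ℝ g := h.differentiable (by norm_num)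
  have hf'd : Differentiable ℝ f' := fun s => (hf' s).differentiableAt
  have : hHess (fun ξ => f (g ξ)) ξ =
      f' (g ξ) • hHess g ξ + f'' (g ξ) • vecMulVec (hGrad g ξ) (hGrad g ξ) := by
    ext i j
    rw [Matrix.add_apply, Matrix.smul_apply, Matrix.smul_apply, hHess_eq, hHess_eq, Vd_comp hd hf,
      Vd_mul (show Differentiable ℝ (fun ξ => f' (g ξ)) from hf'd.comp hd) ((Vd_contDiff h i).differentiable (by norm_num)), Vd_comp hd hf',
      vecMulVec_apply, hGrad_eq, hGrad_eq, smul_eq_mul, smul_eq_mul]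
    ring
  have hs : (vecMulVec (hGrad g ξ) (hGrad g ξ))ᵀ = vecMulVec (hGrad g ξ) (hGrad g ξ) := by
    ext i j; simp [vecMulVec_apply, mul_comm]
  simp only [hHessSym, this, transpose_add, transpose_smul, hs]
  ext i j
  simp only [Matrix.add_apply, Matrix.smul_apply, smul_eq_mul]
  ring

lemma hHessSym_symm (g : Heis n → ℝ) (ξ : Heis n) : (hHessSym g ξ).IsSymm := by
  unfold hHessSym
  refine IsSymm.smul ?_ _
  rw [IsSymm, transpose_add, transpose_transpose, add_comm]

/-- Second derivatives of linear functions along the fields are antisymmetric. -/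
lemma hHessSym_clm (ℓ : Heis n →L[ℝ] ℝ) (ξ : Heis n) : hHessSym (fun ξ => ℓ ξ) ξ = 0 := by
  have hV : ∀ i, Vd i (fun ξ => ℓ ξ) = fun ξ => ℓ (vecField i ξ) := by
    intro i; ext ξ; simp only [Vd]; rw [ℓ.hasFDerivAt.fderiv]
  have hx : ∀ k : Fin n, HasFDerivAt (fun η : Heis n => vecField (Sum.inl k) η)
      ((0 : Heis n →L[ℝ] (Fin n → ℝ)).prod ((0 : Heis n →L[ℝ] (Fin n → ℝ)).prod
        ((2 : ℝ) • ((ContinuousLinearMap.proj k : (Fin n → ℝ) →L[ℝ] ℝ).comp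
          ((ContinuousLinearMap.fst ℝ _ _).comp (ContinuousLinearMap.snd ℝ _ _)))))) ξ := by
    intro k
    refine HasFDerivAt.prodMk (hasFDerivAt_const _ _) (HasFDerivAt.prodMk (hasFDerivAt_const _ _) ?_)
    exact ContinuousLinearMap.hasFDerivAt (((2 : ℝ) • ((ContinuousLinearMap.proj k : (Fin n → ℝ) →L[ℝ] ℝ).comp
          ((ContinuousLinearMap.fst ℝ _ _).comp (ContinuousLinearMap.snd ℝ _ _)))) : Heis n →L[ℝ] ℝ)
  have hy : ∀ k : Fin n, HasFDerivAt (fun η : Heis n => vecField (Sum.inr k) η)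
      ((0 : Heis n →L[ℝ] (Fin n → ℝ)).prod ((0 : Heis n →L[ℝ] (Fin n → ℝ)).prod
        (-((2 : ℝ) • ((ContinuousLinearMap.proj k : (Fin n → ℝ) →L[ℝ] ℝ).comp
          (ContinuousLinearMap.fst ℝ (Fin n → ℝ) ((Fin n → ℝ) × ℝ))))))) ξ := by
    intro k
    refine HasFDerivAt.prodMk (hasFDerivAt_const _ _) (HasFDerivAt.prodMk (hasFDerivAt_const _ _) ?_)
    exact ContinuousLinearMap.hasFDerivAt ((-((2 : ℝ) • ((ContinuousLinearMap.proj k : (Fin n → ℝ) →L[ℝ] ℝ).comp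
          (ContinuousLinearMap.fst ℝ (Fin n → ℝ) ((Fin n → ℝ) × ℝ))))) : Heis n →L[ℝ] ℝ)
  have hxd : ∀ (k : Fin n) (j : HIdx n), hHess (fun ξ => ℓ ξ) ξ (Sum.inl k) j =
      ℓ (0, 0, 2 * (vecField j ξ).2.1 k) := by
    intro k j
    rw [hHess_eq, hV]
    have := (ℓ.hasFDerivAt.comp ξ (hx k)).fderiv
    have h' : fderiv ℝ (fun ξ => ℓ (vecField (Sum.inl k) ξ)) ξ = _ := this
    simp only [Vd, h']
    rfl
  have hyd : ∀ (k : Fin n) (j : HIdx n), hHess (fun ξ => ℓ ξ) ξ (Sum.inr k) j =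
      ℓ (0, 0, -(2 * (vecField j ξ).1 k)) := by
    intro k j
    rw [hHess_eq, hV]
    have := (ℓ.hasFDerivAt.comp ξ (hy k)).fderiv
    have h' : fderiv ℝ (fun ξ => ℓ (vecField (Sum.inr k) ξ)) ξ = _ := this
    simp only [Vd, h']
    rfl
  ext i j
  simp only [hHessSym, Matrix.smul_apply, Matrix.add_apply, transpose_apply, Matrix.zero_apply]
  rcases i with i | i <;> rcases j with j | j <;>
    simp only [hxd, hyd, ← map_add] <;>
    simp [vecField, Pi.single_apply, eq_comm]
  all_goals exact (map_zero ℓ).symm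

lemma contDiff_zsq : ContDiff ℝ 2 (zsq : Heis n → ℝ) := by
  unfold zsq
  fun_prop

lemma zsq_fderiv (η v : Heis n) :
    fderiv ℝ zsq η v = ∑ i, (2 * η.1 i * v.1 i + 2 * η.2.1 i * v.2.1 i) := by
  have hx : ∀ i : Fin n, HasFDerivAt (fun ξ : Heis n => ξ.1 i)
      ((ContinuousLinearMap.proj i : (Fin n → ℝ) →L[ℝ] ℝ).comp
          (ContinuousLinearMap.fst ℝ (Fin n → ℝ) ((Fin n → ℝ) × ℝ))) η := fun i =>
    ContinuousLinearMap.hasFDerivAt ((ContinuousLinearMap.proj i : (Fin n → ℝ) →L[ℝ] ℝ).comp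
          (ContinuousLinearMap.fst ℝ (Fin n → ℝ) ((Fin n → ℝ) × ℝ)))
  have hy : ∀ i : Fin n, HasFDerivAt (fun ξ : Heis n => ξ.2.1 i)
      ((ContinuousLinearMap.proj i : (Fin n → ℝ) →L[ℝ] ℝ).comp
          ((ContinuousLinearMap.fst ℝ (Fin n → ℝ) ℝ).comp
            (ContinuousLinearMap.snd ℝ (Fin n → ℝ) ((Fin n → ℝ) × ℝ)))) η := fun i =>
    ContinuousLinearMap.hasFDerivAt ((ContinuousLinearMap.proj i : (Fin n → ℝ) →L[ℝ] ℝ).comp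
          ((ContinuousLinearMap.fst ℝ (Fin n → ℝ) ℝ).comp
            (ContinuousLinearMap.snd ℝ (Fin n → ℝ) ((Fin n → ℝ) × ℝ))))
  have h := HasFDerivAt.fun_sum (u := Finset.univ)
    (fun i _ => ((hx i).pow 2).add ((hy i).pow 2))
  have h2 : fderiv ℝ zsq η = _ := h.fderiv
  rw [h2]
  simp

lemma hGrad_zsq_inl (ξ : Heis n) (k : Fin n) : hGrad zsq ξ (Sum.inl k) = 2 * ξ.1 k := by
  unfold hGrad
  rw [zsq_fderiv]
  simp [vecField, Pi.single_apply]

lemma hGrad_zsq_inr (ξ : Heis n) (k : Fin n) : hGrad zsq ξ (Sum.inr k) = 2 * ξ.2.1 k := by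
  unfold hGrad
  rw [zsq_fderiv]
  simp [vecField, Pi.single_apply]

lemma hHessSym_zsq (ξ : Heis n) : hHessSym zsq ξ = (2 : ℝ) • (1 : HMat n) := by
  have h1 : ∀ k : Fin n, Vd (Sum.inl k) (zsq : Heis n → ℝ) =
      ((2 : ℝ) • ((ContinuousLinearMap.proj k : (Fin n → ℝ) →L[ℝ] ℝ).comp
          (ContinuousLinearMap.fst ℝ (Fin n → ℝ) ((Fin n → ℝ) × ℝ))) : Heis n →L[ℝ] ℝ) := by
    intro k; ext ξ; exact hGrad_zsq_inl ξ k
  have h2 : ∀ k : Fin n, Vd (Sum.inr k) (zsq : Heis n → ℝ) =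
      ((2 : ℝ) • ((ContinuousLinearMap.proj k : (Fin n → ℝ) →L[ℝ] ℝ).comp
          ((ContinuousLinearMap.fst ℝ (Fin n → ℝ) ℝ).comp
            (ContinuousLinearMap.snd ℝ (Fin n → ℝ) ((Fin n → ℝ) × ℝ)))) : Heis n →L[ℝ] ℝ) := by
    intro k; ext ξ; exact hGrad_zsq_inr ξ k
  have h : hHess zsq ξ = (2 : ℝ) • (1 : HMat n) := by
    ext i j
    rw [hHess_eq]
    rcases i with i | i
    · rw [h1, Vd, ContinuousLinearMap.fderiv]
      rcases j with j | j <;> simp [vecField, Pi.single_apply, Matrix.one_apply]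
    · rw [h2, Vd, ContinuousLinearMap.fderiv]
      rcases j with j | j <;> simp [vecField, Pi.single_apply, Matrix.one_apply]
  rw [hHessSym, h, transpose_smul, transpose_one, ← add_smul, smul_smul]
  norm_num

end HeisCalculus

section HeisConv

variable {n : ℕ}

/-- The Euclidean square on `ℍⁿ = ℝ^{2n+1}`. -/
def Nq (ξ : Heis n) : ℝ := zsq ξ + ξ.2.2 ^ 2

lemma zsq_nonneg (ξ : Heis n) : 0 ≤ zsq ξ :=
  Finset.sum_nonneg fun i _ => by positivity

lemma Nq_nonneg (ξ : Heis n) : 0 ≤ Nq ξ := add_nonneg (zsq_nonneg ξ) (sq_nonneg _)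

lemma Nq_zero : Nq (0 : Heis n) = 0 := by simp [Nq, zsq]

lemma contDiff_Nq : ContDiff ℝ 2 (Nq : Heis n → ℝ) := by
  unfold Nq
  exact contDiff_zsq.add (by fun_prop)

lemma norm_sq_le_Nq (ξ : Heis n) : ‖ξ‖ ^ 2 ≤ Nq ξ := by
  have h1 : ∀ i, ξ.1 i ^ 2 ≤ Nq ξ := by
    intro i
    have := Finset.single_le_sum (f := fun i => ξ.1 i ^ 2 + ξ.2.1 i ^ 2)
      (fun i _ => by positivity) (Finset.mem_univ i)
    unfold Nq zsq
    nlinarith [sq_nonneg (ξ.2.1 i), sq_nonneg ξ.2.2]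
  have h2 : ∀ i, ξ.2.1 i ^ 2 ≤ Nq ξ := by
    intro i
    have := Finset.single_le_sum (f := fun i => ξ.1 i ^ 2 + ξ.2.1 i ^ 2)
      (fun i _ => by positivity) (Finset.mem_univ i)
    unfold Nq zsq
    nlinarith [sq_nonneg (ξ.1 i), sq_nonneg ξ.2.2]
  have h3 : ξ.2.2 ^ 2 ≤ Nq ξ := by
    unfold Nq; linarith [zsq_nonneg ξ]
  have h : ‖ξ‖ ≤ Real.sqrt (Nq ξ) := by
    have key : ∀ s : ℝ, s ^ 2 ≤ Nq ξ → ‖s‖ ≤ Real.sqrt (Nq ξ) := by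
      intro s hs
      rw [Real.norm_eq_abs]
      exact Real.abs_le_sqrt hs
    rw [Prod.norm_def, Prod.norm_def]
    refine max_le ?_ (max_le ?_ ?_)
    · exact (pi_norm_le_iff_of_nonneg (Real.sqrt_nonneg _)).2 fun i => key _ (h1 i)
    · exact (pi_norm_le_iff_of_nonneg (Real.sqrt_nonneg _)).2 fun i => key _ (h2 i)
    · exact key _ h3
  calc ‖ξ‖ ^ 2 ≤ Real.sqrt (Nq ξ) ^ 2 := by gcongr
    _ = Nq ξ := Real.sq_sqrt (Nq_nonneg ξ)

lemma coord_le_norm (ξ : Heis n) :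
    (∀ i, |ξ.1 i| ≤ ‖ξ‖) ∧ (∀ i, |ξ.2.1 i| ≤ ‖ξ‖) ∧ |ξ.2.2| ≤ ‖ξ‖ := by
  refine ⟨fun i => ?_, fun i => ?_, ?_⟩
  · exact (norm_le_pi_norm ξ.1 i).trans (norm_fst_le ξ)
  · exact (norm_le_pi_norm ξ.2.1 i).trans ((norm_fst_le ξ.2).trans (norm_snd_le ξ))
  · exact (norm_snd_le ξ.2).trans (norm_snd_le ξ)

lemma zsq_le (ξ : Heis n) : zsq ξ ≤ 2 * n * ‖ξ‖ ^ 2 := by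
  obtain ⟨h1, h2, h3⟩ := coord_le_norm ξ
  have hs : ∀ s : ℝ, |s| ≤ ‖ξ‖ → s ^ 2 ≤ ‖ξ‖ ^ 2 := fun s hs => by
    rw [← sq_abs]; gcongr
  have : zsq ξ ≤ ∑ i : Fin n, (‖ξ‖ ^ 2 + ‖ξ‖ ^ 2) :=
    Finset.sum_le_sum fun i _ => add_le_add (hs _ (h1 i)) (hs _ (h2 i))
  simp at this
  linarith

lemma Nq_le (ξ : Heis n) : Nq ξ ≤ (2 * n + 1) * ‖ξ‖ ^ 2 := by
  obtain ⟨h1, h2, h3⟩ := coord_le_norm ξ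
  have hs : ξ.2.2 ^ 2 ≤ ‖ξ‖ ^ 2 := by rw [← sq_abs]; gcongr
  have := zsq_le ξ
  unfold Nq
  linarith

/-- Polarization of `zsq`. -/
def zB (a : Heis n) : Heis n →L[ℝ] ℝ :=
  LinearMap.toContinuousLinearMap
    { toFun := fun v => ∑ i, (2 * a.1 i * v.1 i + 2 * a.2.1 i * v.2.1 i)
      map_add' := by
        intro v w
        rw [← Finset.sum_add_distrib]
        refine Finset.sum_congr rfl fun i _ => ?_
        simp only [Prod.fst_add, Prod.snd_add, Pi.add_apply]
        ring
      map_smul' := by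
        intro r v
        simp only [RingHom.id_apply, smul_eq_mul, Finset.mul_sum]
        refine Finset.sum_congr rfl fun i _ => ?_
        simp only [Prod.smul_fst, Prod.smul_snd, Pi.smul_apply, smul_eq_mul]
        ring }

lemma zB_apply (a v : Heis n) :
    zB a v = ∑ i, (2 * a.1 i * v.1 i + 2 * a.2.1 i * v.2.1 i) := rfl

lemma zsq_add (a v : Heis n) : zsq (a + v) = zsq a + zB a v + zsq v := by
  rw [zB_apply]
  simp only [zsq, ← Finset.sum_add_distrib]
  refine Finset.sum_congr rfl fun i _ => ?_
  simp only [Prod.fst_add, Prod.snd_add, Pi.add_apply]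
  ring

lemma zsq_convex (x y : Heis n) : zsq x + zB x (y - x) ≤ zsq y := by
  have := zsq_add x (y - x)
  rw [add_sub_cancel] at this
  linarith [zsq_nonneg (y - x)]

/-- Polarization of `Nq`. -/
def NB (a : Heis n) : Heis n →L[ℝ] ℝ :=
  zB a + (2 * a.2.2) • ((ContinuousLinearMap.snd ℝ (Fin n → ℝ) ℝ).comp
            (ContinuousLinearMap.snd ℝ (Fin n → ℝ) ((Fin n → ℝ) × ℝ)))

lemma NB_apply (a v : Heis n) : NB a v = zB a v + 2 * a.2.2 * v.2.2 := rfl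

lemma Nq_add (a v : Heis n) : Nq (a + v) = Nq a + NB a v + Nq v := by
  rw [NB_apply]
  simp only [Nq, zsq_add, Prod.snd_add]
  ring

lemma Nq_neg (v : Heis n) : Nq (-v) = Nq v := by simp [Nq, zsq]

lemma hinv_eq (a : Heis n) : hinv a = -a := rfl

lemma hmul_hinv_expand (η x y : Heis n) :
    hmul η (hinv y) = hmul η (hinv x) + -(hlin η (y - x)) := by
  rw [hmul_eq, hmul_eq, hinv_eq, hinv_eq, map_neg, map_neg, map_sub]
  abel

lemma Nq_expand (η x y : Heis n) : Nq (hmul η (hinv y)) =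
    Nq (hmul η (hinv x)) + NB (hmul η (hinv x)) (-(hlin η (y - x))) + Nq (hlin η (y - x)) := by
  rw [hmul_hinv_expand η x y, Nq_add, Nq_neg]

lemma norm_hlin_le (η v : Heis n) : ‖hlin η v‖ ≤ (1 + 4 * n * ‖η‖) * ‖v‖ := by
  obtain ⟨a1, a2, a3⟩ := coord_le_norm η
  obtain ⟨b1, b2, b3⟩ := coord_le_norm v
  have hle : ‖v‖ ≤ (1 + 4 * n * ‖η‖) * ‖v‖ := by
    nlinarith [mul_nonneg (mul_nonneg (Nat.cast_nonneg (α := ℝ) n) (norm_nonneg η)) (norm_nonneg v)]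
  rw [hlin_apply, Prod.norm_def, Prod.norm_def]
  refine max_le ?_ (max_le ?_ ?_)
  · exact (norm_fst_le v).trans hle
  · exact ((norm_fst_le v.2).trans (norm_snd_le v)).trans hle
  · have hs : |∑ i, (η.2.1 i * v.1 i - η.1 i * v.2.1 i)| ≤ ∑ i : Fin n, 2 * (‖η‖ * ‖v‖) := by
      refine (Finset.abs_sum_le_sum_abs _ _).trans (Finset.sum_le_sum fun i _ => ?_)
      refine (abs_sub _ _).trans ?_
      rw [abs_mul, abs_mul]
      have := mul_le_mul (a2 i) (b1 i) (abs_nonneg _) (norm_nonneg _)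
      have := mul_le_mul (a1 i) (b2 i) (abs_nonneg _) (norm_nonneg _)
      linarith
    simp only [Finset.sum_const, Finset.card_univ, Fintype.card_fin, nsmul_eq_mul] at hs
    simp only [Real.norm_eq_abs]
    calc |v.2.2 + 2 * ∑ i, (η.2.1 i * v.1 i - η.1 i * v.2.1 i)|
        ≤ |v.2.2| + |2 * ∑ i, (η.2.1 i * v.1 i - η.1 i * v.2.1 i)| := abs_add_le _ _
      _ = |v.2.2| + 2 * |∑ i, (η.2.1 i * v.1 i - η.1 i * v.2.1 i)| := by
          rw [abs_mul, abs_of_pos (by norm_num : (0:ℝ) < 2)]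
      _ ≤ _ := by linarith

lemma Nq_hlin_le {R : ℝ} {η : Heis n} (hη : ‖η‖ ≤ R) (v : Heis n) :
    Nq (hlin η v) ≤ ((2 * n + 1) * (1 + 4 * n * R) ^ 2) * ‖v‖ ^ 2 := by
  refine (Nq_le _).trans ?_
  have h : ‖hlin η v‖ ≤ (1 + 4 * n * R) * ‖v‖ := by
    refine (norm_hlin_le η v).trans ?_
    gcongr
  rw [mul_assoc, ← mul_pow]
  gcongr

lemma continuous_hmul_hinv : Continuous fun p : Heis n × Heis n => hmul p.1 (hinv p.2) := by
  unfold hmul hinv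
  fun_prop

/-- `u` is the sup-convolution of `ψ` over `C`. -/
structure IsSupConv (C : Set (Heis n)) (ψ : Heis n → ℝ) (l : ℝ) (u : Heis n → ℝ) : Prop where
  cont : Continuous u
  le : ∀ x, ∀ η ∈ C, ψ η - l * Nq (hmul η (hinv x)) ≤ u x
  att : ∀ x, ∃ η ∈ C, u x = ψ η - l * Nq (hmul η (hinv x))

lemma exists_supConv {C : Set (Heis n)} (hC : IsCompact C) (hne : C.Nonempty) {ψ : Heis n → ℝ}
    (hψ : ContinuousOn ψ C) (l : ℝ) : ∃ u, IsSupConv C ψ l u := by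
  have hcs : CompactSpace C := isCompact_iff_compactSpace.1 hC
  have hne' : Nonempty C := hne.to_subtype
  let F : Heis n → C → ℝ := fun x η => ψ η - l * Nq (hmul η (hinv x))
  have hF : Continuous (fun p : Heis n × C => F p.1 p.2) := by
    have h1 : Continuous fun η : C => ψ η := continuousOn_iff_continuous_domRestrict.1 hψ
    have h2 : Continuous fun p : Heis n × C => Nq (hmul (p.2 : Heis n) (hinv p.1)) :=
      contDiff_Nq.continuous.comp (continuous_hmul_hinv.comp
        ((continuous_subtype_val.comp continuous_snd).prodMk continuous_fst))
    exact (h1.comp continuous_snd).sub (continuous_const.mul h2)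
  have hFx : ∀ x, Continuous (F x) := fun x => hF.comp (Continuous.prodMk_right x)
  refine ⟨fun x => sSup (F x '' Set.univ), ?_, ?_, ?_⟩
  · exact isCompact_univ.continuous_sSup hF
  · intro x η hη
    exact le_csSup (isCompact_univ.image (hFx x)).bddAbove ⟨⟨η, hη⟩, trivial, rfl⟩
  · intro x
    obtain ⟨η, -, hη⟩ := isCompact_univ.exists_sSup_image_eq Set.univ_nonempty (hFx x).continuousOn
    exact ⟨η, η.2, hη⟩

lemma IsSupConv.semiconvex {C : Set (Heis n)} {ψ u : Heis n → ℝ} {l R : ℝ}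
    (h : IsSupConv C ψ l u) (hl : 0 ≤ l) (hR : ∀ η ∈ C, ‖η‖ ≤ R) (x : Heis n) :
    ∃ p : Heis n →L[ℝ] ℝ, ∀ y,
      u x + p (y - x) - (l * ((2 * n + 1) * (1 + 4 * n * R) ^ 2)) * ‖y - x‖ ^ 2 ≤ u y := by
  obtain ⟨η, hη, he⟩ := h.att x
  refine ⟨l • ((NB (hmul η (hinv x))).comp (hlin η)), fun y => ?_⟩
  have h1 := h.le y η hη
  rw [Nq_expand η x y, map_neg] at h1
  have h2 := mul_le_mul_of_nonneg_left (Nq_hlin_le (hR η hη) (y - x)) hl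
  rw [he]
  simp only [_root_.smul_apply, ContinuousLinearMap.comp_apply, smul_eq_mul]
  linarith

end HeisConv

section Touch

variable {n : ℕ}

lemma tendsto_hmul (a ξ : Heis n) : Tendsto (hmul a) (𝓝 ξ) (𝓝 (hmul a ξ)) :=
  (contDiff_hmul a).continuous.tendsto ξ

lemma touch_aux (η x : Heis n) : hmul (hinv (hmul η (hinv x))) η = x := by
  rw [hinv_hmul_rev, hinv_hinv', hmul_assoc, hinv_hmul, hmul_zero']

lemma touch_aux2 (ζ ξ : Heis n) : hmul ξ (hinv (hmul (hinv ζ) ξ)) = ζ := by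
  rw [hinv_hmul_rev, hinv_hinv', ← hmul_assoc, hmul_hinv, zero_hmul']

lemma touch_sub {Ω : Set (Heis n)} {a b c : ℝ} {S : Set (HMat n)} {ψ u : Heis n → ℝ} {l : ℝ}
    (hψ : IsSubsolution Ω (LquadC a b c) S (fun ξ => ((ψ ξ : ℝ) : EReal)))
    (hu : IsSupConv (closure Ω) ψ l u) {x η : Heis n} (hη : η ∈ Ω)
    (he : u x = ψ η - l * Nq (hmul η (hinv x))) {φ : Heis n → ℝ} (hφ : ContDiff ℝ 2 φ)
    (hx : φ x = u x) (hle : ∀ᶠ y in 𝓝 x, u y ≤ φ y) :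
    Fop (LquadC a b c) φ x ∈ closure S := by
  set ζ := hmul η (hinv x) with hζ
  have hx' : hmul (hinv ζ) η = x := touch_aux η x
  have key := hψ η hη (fun ξ => φ (hmul (hinv ζ) ξ) + l * Nq ζ)
    ((hφ.comp (contDiff_hmul _)).add contDiff_const).contDiffOn ?_ ?_
  · rwa [Fop_comp_hmul hφ, hx'] at key
  · simp only [hx', hx, he]
    congr 1; ring
  · have ht := tendsto_hmul (hinv ζ) η
    rw [hx'] at ht
    filter_upwards [ht.eventually hle] with ξ hξ hξΩ
    have h1 := hu.le (hmul (hinv ζ) ξ) ξ (subset_closure hξΩ)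
    rw [touch_aux2] at h1
    simp only [EReal.coe_le_coe_iff]
    linarith

lemma touch_super {Ω : Set (Heis n)} {a b c : ℝ} {S : Set (HMat n)} {ψ v : Heis n → ℝ} {l : ℝ}
    (hψ : IsSupersolution Ω (LquadC a b c) S (fun ξ => ((ψ ξ : ℝ) : EReal)))
    (hv : IsSupConv (closure Ω) (fun ξ => -ψ ξ) l v) {x η : Heis n} (hη : η ∈ Ω)
    (he : v x = -ψ η - l * Nq (hmul η (hinv x))) {φ : Heis n → ℝ} (hφ : ContDiff ℝ 2 φ)
    (hx : φ x = -v x) (hle : ∀ᶠ y in 𝓝 x, φ y ≤ -v y) :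
    Fop (LquadC a b c) φ x ∉ S := by
  set ζ := hmul η (hinv x) with hζ
  have hx' : hmul (hinv ζ) η = x := touch_aux η x
  have key := hψ η hη (fun ξ => φ (hmul (hinv ζ) ξ) + -(l * Nq ζ))
    ((hφ.comp (contDiff_hmul _)).add contDiff_const).contDiffOn ?_ ?_
  · rwa [Fop_comp_hmul hφ, hx'] at key
  · simp only [hx', hx, he]
    congr 1; ring
  · have ht := tendsto_hmul (hinv ζ) η
    rw [hx'] at ht
    filter_upwards [ht.eventually hle] with ξ hξ hξΩ
    have h1 := hv.le (hmul (hinv ζ) ξ) ξ (subset_closure hξΩ)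
    rw [touch_aux2] at h1
    simp only [EReal.coe_le_coe_iff]
    linarith

end Touch

section Select

variable {n : ℕ}

lemma eq_of_Nq_hmul {η x : Heis n} (h : Nq (hmul η (hinv x)) = 0) : η = x := by
  have h0 : hmul η (hinv x) = 0 := by
    have h1 := norm_sq_le_Nq (hmul η (hinv x))
    rw [h] at h1
    have h2 : ‖hmul η (hinv x)‖ ^ 2 = 0 := le_antisymm h1 (sq_nonneg _)
    exact norm_eq_zero.1 (pow_eq_zero_iff (two_ne_zero) |>.1 h2)
  have h3 := hmul_assoc η (hinv x) x
  rw [h0, hinv_hmul, hmul_zero', zero_hmul'] at h3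
  exact h3.symm

lemma supConv_lower {C : Set (Heis n)} {ψ u : Heis n → ℝ} {l : ℝ}
    (h : IsSupConv C ψ l u) {x : Heis n} (hx : x ∈ C) : ψ x ≤ u x := by
  have := h.le x x hx
  rw [hmul_hinv, Nq_zero] at this
  linarith

lemma supConv_upper {C : Set (Heis n)} {ψ u : Heis n → ℝ} {l C0 : ℝ} (hl : 0 ≤ l)
    (hC0 : ∀ x ∈ C, |ψ x| ≤ C0) (h : IsSupConv C ψ l u) (x : Heis n) : u x ≤ C0 := by
  obtain ⟨η, hη, he⟩ := h.att x
  have := (abs_le.1 (hC0 η hη)).2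
  have := mul_nonneg hl (Nq_nonneg (hmul η (hinv x)))
  linarith

lemma supConv_abs {C : Set (Heis n)} {ψ u : Heis n → ℝ} {l C0 : ℝ} (hl : 0 ≤ l)
    (hC0 : ∀ x ∈ C, |ψ x| ≤ C0) (h : IsSupConv C ψ l u) {x : Heis n} (hx : x ∈ C) :
    |u x| ≤ C0 := by
  rw [abs_le]
  exact ⟨(abs_le.1 (hC0 x hx)).1.trans (supConv_lower h hx), supConv_upper hl hC0 h x⟩

/-- Penalization: limit points of attaining pairs lie on the diagonal. -/
lemma limit_diag {C : Set (Heis n)} {ψ : Heis n → ℝ} {C0 : ℝ}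
    (hC0 : ∀ x ∈ C, |ψ x| ≤ C0) {u : ℕ → Heis n → ℝ}
    (hu : ∀ k : ℕ, IsSupConv C ψ ((k : ℝ) + 1) (u k)) {x η : ℕ → Heis n}
    (hx : ∀ k, x k ∈ C) (hη : ∀ k, η k ∈ C)
    (he : ∀ k : ℕ, u k (x k) = ψ (η k) - ((k : ℝ) + 1) * Nq (hmul (η k) (hinv (x k))))
    {g : ℕ → ℕ} (hg : StrictMono g) {a b : Heis n} (ha : Tendsto (x ∘ g) atTop (𝓝 a))
    (hb : Tendsto (η ∘ g) atTop (𝓝 b)) : b = a := by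
  apply eq_of_Nq_hmul
  have h1 : ∀ k : ℕ, Nq (hmul (η k) (hinv (x k))) ≤ 2 * C0 * (1 / ((k : ℝ) + 1)) := by
    intro k
    have hk : (0 : ℝ) < (k : ℝ) + 1 := by positivity
    have h2 := supConv_lower (hu k) (hx k)
    rw [he k] at h2
    have h3 := (abs_le.1 (hC0 _ (hx k))).1
    have h4 := (abs_le.1 (hC0 _ (hη k))).2
    rw [mul_one_div, le_div_iff₀ hk]
    linarith
  have hc : Continuous fun p : Heis n × Heis n => Nq (hmul p.1 (hinv p.2)) :=
    contDiff_Nq.continuous.comp continuous_hmul_hinv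
  have hp : Tendsto (fun k => (η (g k), x (g k))) atTop (𝓝 (b, a)) := hb.prodMk_nhds ha
  have h2 : Tendsto (fun k => Nq (hmul (η (g k)) (hinv (x (g k))))) atTop
      (𝓝 (Nq (hmul b (hinv a)))) := by
    have hc' := hc.tendsto (b, a)
    simp only at hc'
    have := hc'.comp hp
    exact this
  have h3 : Tendsto (fun k : ℕ => 2 * C0 * (1 / ((g k : ℝ) + 1))) atTop (𝓝 (2 * C0 * 0)) :=
    (tendsto_one_div_add_atTop_nhds_zero_nat.comp hg.tendsto_atTop).const_mul _
  rw [mul_zero] at h3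
  have h5 : Tendsto (fun k => Nq (hmul (η (g k)) (hinv (x (g k))))) atTop (𝓝 0) :=
    squeeze_zero (fun k => Nq_nonneg _) (fun k => h1 (g k)) h3
  exact tendsto_nhds_unique h2 h5

lemma select {Ω : Set (Heis n)} (hΩ : IsOpen Ω) (hC : IsCompact (closure Ω))
    {ψ χ : Heis n → ℝ} (hψ : ContinuousOn ψ (closure Ω)) (hχ : ContinuousOn χ (closure Ω))
    {C0 : ℝ} (hψ0 : ∀ x ∈ closure Ω, |ψ x| ≤ C0) (hχ0 : ∀ x ∈ closure Ω, |χ x| ≤ C0)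
    {u v : ℕ → Heis n → ℝ} (hu : ∀ k : ℕ, IsSupConv (closure Ω) ψ ((k : ℝ) + 1) (u k))
    (hv : ∀ k : ℕ, IsSupConv (closure Ω) χ ((k : ℝ) + 1) (v k))
    {f : ℝ → ℝ} {g : Heis n → ℝ} (hf : Continuous f) (hg : Continuous g)
    (hmono : MonotoneOn f (Set.Icc (-C0) C0)) {z : Heis n} (hz : z ∈ closure Ω)
    (hbd : ∀ a ∈ frontier Ω, f (ψ a) + g a + χ a < f (ψ z) + g z + χ z) :
    ∃ k : ℕ, ∀ ℓ : Heis n →L[ℝ] ℝ, ‖ℓ‖ ≤ 1 / ((k : ℝ) + 1) → ∀ x ∈ closure Ω,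
      (∀ y ∈ closure Ω, f (u k y) + g y + v k y - ℓ y ≤ f (u k x) + g x + v k x - ℓ x) →
      ∀ η ∈ closure Ω, u k x = ψ η - ((k : ℝ) + 1) * Nq (hmul η (hinv x)) →
      ∀ θ ∈ closure Ω, v k x = χ θ - ((k : ℝ) + 1) * Nq (hmul θ (hinv x)) →
      x ∈ Ω ∧ η ∈ Ω ∧ θ ∈ Ω := by
  by_contra! hcon
  choose ℓ hℓ x hx hmax η hη heη θ hθ heθ hout using hcon
  obtain ⟨⟨a, b, d⟩, habd, s, hs, hlim⟩ := (hC.prod (hC.prod hC)).tendsto_subseq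
    (x := fun k => (x k, η k, θ k)) (fun k => ⟨hx k, hη k, hθ k⟩)
  have ha : Tendsto (x ∘ s) atTop (𝓝 a) := (continuous_fst.tendsto _).comp hlim
  have hb : Tendsto (η ∘ s) atTop (𝓝 b) :=
    ((continuous_fst.comp continuous_snd).tendsto _).comp hlim
  have hd : Tendsto (θ ∘ s) atTop (𝓝 d) :=
    ((continuous_snd.comp continuous_snd).tendsto _).comp hlim
  have hba : b = a := limit_diag hψ0 hu hx hη heη hs ha hb
  have hda : d = a := limit_diag hχ0 hv hx hθ heθ hs ha hd
  subst hba
  subst hda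
  have haC : d ∈ closure Ω := habd.1
  have hineq : ∀ k : ℕ, f (ψ z) + g z + χ z ≤
      f (ψ (η k)) + g (x k) + χ (θ k) + 1 / ((k : ℝ) + 1) * ‖x k - z‖ := by
    intro k
    have hk : (0 : ℝ) ≤ (k : ℝ) + 1 := by positivity
    have h1 := hmax k z hz
    have h2 : f (ψ z) ≤ f (u k z) := hmono (abs_le.1 (hψ0 z hz))
      (abs_le.1 (supConv_abs hk hψ0 (hu k) hz)) (supConv_lower (hu k) hz)
    have h3 : χ z ≤ v k z := supConv_lower (hv k) hz
    have h4 : f (u k (x k)) ≤ f (ψ (η k)) := by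
      refine hmono (abs_le.1 (supConv_abs hk hψ0 (hu k) (hx k))) (abs_le.1 (hψ0 _ (hη k))) ?_
      rw [heη k]
      linarith [mul_nonneg hk (Nq_nonneg (hmul (η k) (hinv (x k))))]
    have h5 : v k (x k) ≤ χ (θ k) := by
      rw [heθ k]
      linarith [mul_nonneg hk (Nq_nonneg (hmul (θ k) (hinv (x k))))]
    have h6 : -(ℓ k (x k) - ℓ k z) ≤ 1 / ((k : ℝ) + 1) * ‖x k - z‖ := by
      rw [← map_sub]
      refine (neg_le_abs _).trans ?_
      rw [← Real.norm_eq_abs]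
      exact (ℓ k).le_of_opNorm_le (hℓ k) _
    linarith
  have hT : Tendsto (fun k => f (ψ (η (s k))) + g (x (s k)) + χ (θ (s k)) +
      1 / ((s k : ℝ) + 1) * ‖x (s k) - z‖) atTop (𝓝 (f (ψ d) + g d + χ d + 0 * ‖d - z‖)) := by
    have t1 : Tendsto (fun k => ψ (η (s k))) atTop (𝓝 (ψ d)) :=
      (hψ d haC).tendsto.comp (tendsto_nhdsWithin_iff.2 ⟨hb, Eventually.of_forall fun k => hη _⟩)
    have t2 : Tendsto (fun k => χ (θ (s k))) atTop (𝓝 (χ d)) :=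
      (hχ d haC).tendsto.comp (tendsto_nhdsWithin_iff.2 ⟨hd, Eventually.of_forall fun k => hθ _⟩)
    have t3 : Tendsto (fun k => g (x (s k))) atTop (𝓝 (g d)) := (hg.tendsto d).comp ha
    have t4 : Tendsto (fun k => 1 / ((s k : ℝ) + 1)) atTop (𝓝 (0 : ℝ)) :=
      tendsto_one_div_add_atTop_nhds_zero_nat.comp hs.tendsto_atTop
    have t5 : Tendsto (fun k => ‖x (s k) - z‖) atTop (𝓝 ‖d - z‖) :=
      (ha.sub_const z).norm
    exact ((((hf.tendsto _).comp t1).add t3).add t2).add (t4.mul t5)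
  have hge : f (ψ z) + g z + χ z ≤ f (ψ d) + g d + χ d + 0 * ‖d - z‖ :=
    ge_of_tendsto' hT fun k => hineq (s k)
  rw [zero_mul, add_zero] at hge
  have hdΩ : d ∈ Ω := by
    by_contra hdn
    have : d ∈ frontier Ω := by
      rw [frontier, hΩ.interior_eq]
      exact ⟨haC, hdn⟩
    exact absurd (hbd d this) (not_lt.2 hge)
  have hnh := hΩ.mem_nhds hdΩ
  obtain ⟨k, h1, h2, h3⟩ := ((ha.eventually hnh).and
    ((hb.eventually hnh).and (hd.eventually hnh))).exists
  exact hout (s k) h1 h2 h3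

end Select

section JensenApply

lemma jensen_apply {V : Type*} [NormedAddCommGroup V] [NormedSpace ℝ V] [FiniteDimensional ℝ V]
    {Ω E : Set V} (hΩ : IsOpen Ω) {ρ D K r : ℝ} (hρ : 0 < ρ) (hK : 0 ≤ K) (hr : 0 < r)
    (hball : ∀ x ∈ E, Metric.closedBall x ρ ⊆ Ω) (hD : ∀ x ∈ E, ∀ y ∈ E, ‖x - y‖ ≤ D)
    {u v g : V → ℝ} {f f' : ℝ → ℝ} (hf : ∀ s t, f s + f' s * (t - s) ≤ f t)
    (hu : ∀ x, ∃ p : V →L[ℝ] ℝ, ∀ y, u x + p (y - x) - K * ‖y - x‖ ^ 2 ≤ u y)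
    (hv : ∀ x, ∃ p : V →L[ℝ] ℝ, ∀ y, v x + p (y - x) - K * ‖y - x‖ ^ 2 ≤ v y)
    (hg : ∀ x, ∃ p : V →L[ℝ] ℝ, ∀ y, g x + p (y - x) ≤ g y)
    (hf1 : ∀ x ∈ E, 1 / 2 ≤ f' (u x)) (hf2 : ∀ x ∈ E, f' (u x) ≤ 2)
    (hsurj : ∀ ℓ : V →L[ℝ] ℝ, ‖ℓ‖ ≤ r → ∃ x ∈ E, ∀ y ∈ Ω,
      f (u y) + g y + v y ≤ f (u x) + g x + v x + ℓ (y - x))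
    (hEup : ∀ x ∈ E, ∃ ℓ : V →L[ℝ] ℝ, ∀ y ∈ Ω,
      f (u y) + g y + v y ≤ f (u x) + g x + v x + ℓ (y - x)) :
    ∃ x ∈ E, ∃ p : V →L[ℝ] ℝ, ∃ A : V →L[ℝ] (V →L[ℝ] ℝ), ∀ κ > 0, ∀ᶠ y in 𝓝 x,
      |u y - u x - p (y - x) - (1 / 2) * A (y - x) (y - x)| ≤ κ * ‖y - x‖ ^ 2 := by
  refine jensen_alexandrov (Φ := fun x => f (u x) + g x + v x) (K := 3 * K) hΩ hρ (by positivity)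
    hr hball hD hsurj hEup ?_ ?_
  · intro x hx
    obtain ⟨p, hp⟩ := hu x
    obtain ⟨q, hq⟩ := hv x
    obtain ⟨s, hs⟩ := hg x
    refine ⟨f' (u x) • p + s + q, fun y _ => ?_⟩
    have h1 := hf (u x) (u y)
    have h2 := hf1 x hx
    have h3 := hf2 x hx
    have h4 : f' (u x) * (p (y - x) - K * ‖y - x‖ ^ 2) ≤ f' (u x) * (u y - u x) :=
      mul_le_mul_of_nonneg_left (by linarith [hp y]) (by linarith)
    have h5 : f' (u x) * (K * ‖y - x‖ ^ 2) ≤ 2 * (K * ‖y - x‖ ^ 2) := by gcongr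
    have := hq y
    have := hs y
    simp only [_root_.add_apply, _root_.smul_apply, smul_eq_mul]
    linarith
  · intro x hx
    obtain ⟨p, hp⟩ := hu x
    obtain ⟨q, hq⟩ := hv x
    obtain ⟨s, hs⟩ := hg x
    obtain ⟨ℓ, hℓ⟩ := hEup x hx
    have h2 := hf1 x hx
    have hup : ∀ y ∈ Ω, u y - u x ≤ ((f' (u x))⁻¹ • (ℓ - s - q)) (y - x) + 2 * K * ‖y - x‖ ^ 2 := by
      intro y hy
      have h1 := hf (u x) (u y)
      have h3 : f' (u x) * (u y - u x) ≤ (ℓ - s - q) (y - x) + K * ‖y - x‖ ^ 2 := by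
        have := hq y
        have := hs y
        have := hℓ y hy
        simp only [_root_.sub_apply]
        linarith
      have h4 : u y - u x ≤ (f' (u x))⁻¹ * ((ℓ - s - q) (y - x) + K * ‖y - x‖ ^ 2) := by
        rw [← div_eq_inv_mul, le_div_iff₀ (by linarith)]
        linarith
      have h5 : (f' (u x))⁻¹ ≤ 2 := by
        rw [inv_le_comm₀ (by linarith) (by norm_num)]
        linarith
      have h6 : (f' (u x))⁻¹ * (K * ‖y - x‖ ^ 2) ≤ 2 * (K * ‖y - x‖ ^ 2) := by gcongr
      simp only [_root_.smul_apply, smul_eq_mul]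
      linarith
    have hxΩ : x ∈ Ω := hball x hx (Metric.mem_closedBall_self hρ.le)
    have heq : p = ((f' (u x))⁻¹ • (ℓ - s - q)) := by
      refine slope_unique hΩ hxΩ (K := 3 * K) fun y hy => ?_
      have := hup y hy
      have := hp y
      linarith
    refine ⟨p, fun y hy => ?_⟩
    have h7 := hup y hy
    rw [← heq] at h7
    have := hp y
    have : 0 ≤ K * ‖y - x‖ ^ 2 := by positivity
    rw [abs_le]
    constructor <;> linarith

end JensenApply

section Local

variable {n : ℕ}

lemma hGrad_add {g₁ g₂ : Heis n → ℝ} (h₁ : ContDiff ℝ 2 g₁) (h₂ : ContDiff ℝ 2 g₂)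
    (ξ : Heis n) : hGrad (fun ξ => g₁ ξ + g₂ ξ) ξ = hGrad g₁ ξ + hGrad g₂ ξ := by
  ext j
  rw [hGrad_eq, Vd_add (h₁.differentiable (by norm_num)) (h₂.differentiable (by norm_num))]
  rfl

lemma hGrad_const_mul {g : Heis n → ℝ} (h : ContDiff ℝ 2 g) (k : ℝ)
    (ξ : Heis n) : hGrad (fun ξ => k * g ξ) ξ = k • hGrad g ξ := by
  ext j
  rw [hGrad_eq, Vd_const_mul (h.differentiable (by norm_num))]
  rfl

lemma hGrad_comp {g : Heis n → ℝ} (h : ContDiff ℝ 2 g) {f f' : ℝ → ℝ}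
    (hf : ∀ s, HasDerivAt f (f' s) s) (ξ : Heis n) :
    hGrad (fun ξ => f (g ξ)) ξ = f' (g ξ) • hGrad g ξ := by
  ext j
  rw [hGrad_eq, Vd_comp (h.differentiable (by norm_num)) hf]
  rfl

lemma hGrad_add_const (g : Heis n → ℝ) (k : ℝ) (ξ : Heis n) :
    hGrad (fun ξ => g ξ + k) ξ = hGrad g ξ := by
  ext j
  rw [hGrad_eq, Vd_add_const]; rfl

lemma hHessSym_add_const (g : Heis n → ℝ) (k : ℝ) (ξ : Heis n) :
    hHessSym (fun ξ => g ξ + k) ξ = hHessSym g ξ := by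
  have : hHess (fun ξ => g ξ + k) ξ = hHess g ξ := by
    ext i j
    rw [hHess_eq, Vd_add_const]; rfl
  rw [hHessSym, this]; rfl

lemma hGrad_clm (ℓ : Heis n →L[ℝ] ℝ) (ξ : Heis n) :
    hGrad (fun ξ => ℓ ξ) ξ = fun j => ℓ (vecField j ξ) := by
  ext j
  show fderiv ℝ (fun ξ => ℓ ξ) ξ (vecField j ξ) = _
  rw [ℓ.hasFDerivAt.fderiv]

lemma hGrad_Nq_sub (x : Heis n) : hGrad (fun y => Nq (y - x)) x = 0 := by
  have h : IsLocalMin (fun y : Heis n => Nq (y - x)) x := by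
    refine Eventually.of_forall fun y => ?_
    simp only [sub_self, Nq_zero]
    exact Nq_nonneg _
  ext j
  show fderiv ℝ (fun y => Nq (y - x)) x (vecField j x) = 0
  rw [h.fderiv_eq_zero]; rfl

lemma local_contra {S : Set (HMat n)} (hSsymm : ∀ A ∈ S, A.IsSymm)
    (hSpos : ∀ A ∈ S, ∀ B : HMat n, B.PosDef → A + B ∈ S)
    (hScone : ∀ A ∈ S, ∀ c : ℝ, 0 < c → c • A ∈ S)
    {a b c K t s0 ε : ℝ} (hε : 0 < ε) (ht : 0 < t) (ht2 : t ≤ 1 / 2) (hs : s0 = 1 ∨ s0 = -1)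
    (hK : 4 * |a| ≤ K) (hb : s0 * b ≤ 0) (hc : s0 * c ≤ 0)
    {f f' f'' : ℝ → ℝ} (hfC : ContDiff ℝ 2 f) (hf : ∀ s, HasDerivAt f (f' s) s)
    (hf' : ∀ s, HasDerivAt f' (f'' s) s) (hconv : ∀ s t, f s + f' s * (t - s) ≤ f t)
    {u v : Heis n → ℝ} {x : Heis n} (hf1 : f' (u x) = 1 + s0 * t) (hf2 : f'' (u x) = K * t)
    {p : Heis n →L[ℝ] ℝ} {A : Heis n →L[ℝ] (Heis n →L[ℝ] ℝ)}
    (hexp : ∀ κ > 0, ∀ᶠ y in 𝓝 x,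
      |u y - u x - p (y - x) - (1 / 2) * A (y - x) (y - x)| ≤ κ * ‖y - x‖ ^ 2)
    {ℓ : Heis n →L[ℝ] ℝ}
    (hmax : ∀ᶠ y in 𝓝 x, f (u y) + ε * zsq y + v y - ℓ y ≤ f (u x) + ε * zsq x + v x - ℓ x)
    (H1 : ∀ φ : Heis n → ℝ, ContDiff ℝ 2 φ → φ x = u x → (∀ᶠ y in 𝓝 x, u y ≤ φ y) →
      Fop (LquadC a b c) φ x ∈ closure S)
    (H2 : ∀ φ : Heis n → ℝ, ContDiff ℝ 2 φ → φ x = -v x → (∀ᶠ y in 𝓝 x, φ y ≤ -v y) →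
      Fop (LquadC a b c) φ x ∉ S)
    {q : HIdx n → ℝ} (hqd : q = ε • hGrad zsq x + hGrad (fun ξ => (-ℓ) ξ) x)
    (hq : (q ⬝ᵥ q) * (3 * (|a| + |b| + |c|)) ≤ ε * t) : False := by
  set T : Heis n → ℝ := fun y => u x + p (y - x) + (1 / 2) * A (y - x) (y - x) with hT
  set Qf : Heis n → ℝ := fun y => Nq (y - x) with hQf
  have hTC : ContDiff ℝ 2 T := by
    have h1 : ContDiff ℝ 2 (fun y : Heis n => y - x) := contDiff_id.sub contDiff_const
    exact (contDiff_const.add (p.contDiff.comp h1)).add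
      (contDiff_const.mul ((A.contDiff.comp h1).clm_apply h1))
  have hQC : ContDiff ℝ 2 Qf := contDiff_Nq.comp (contDiff_id.sub contDiff_const)
  have hTx : T x = u x := by simp [hT]
  have hQx : Qf x = 0 := by simp [hQf, Nq_zero]
  set H := hHessSym T x
  set Q := hHessSym Qf x
  set P := hGrad T x with hP
  set SQ := ∑ i, ∑ j, |Q i j| with hSQ
  have hSQ0 : 0 ≤ SQ := Finset.sum_nonneg fun i _ => Finset.sum_nonneg fun j _ => abs_nonneg _
  set κ := ε / (8 * (SQ + 1)) with hκ
  have hκ0 : 0 < κ := by positivity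
  have hκ8 : κ * SQ ≤ ε / 8 := by
    rw [hκ, div_mul_eq_mul_div, div_le_div_iff₀ (by positivity) (by norm_num)]
    nlinarith
  set σ := f' (u x) with hσ
  have hσ1 : 1 / 2 ≤ σ := by rcases hs with h | h <;> rw [hf1, h] <;> linarith
  have hσ2 : σ ≤ 3 / 2 := by rcases hs with h | h <;> rw [hf1, h] <;> linarith
  have hnear : ∀ᶠ y in 𝓝 x, |u y - T y| ≤ κ * Qf y := by
    filter_upwards [hexp κ hκ0] with y hy
    have h1 := mul_le_mul_of_nonneg_left (norm_sq_le_Nq (y - x)) hκ0.le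
    refine le_trans (le_of_eq ?_) (hy.trans h1)
    congr 1
    simp only [hT]; ring
  -- first test function
  set φ₁ : Heis n → ℝ := fun y => T y + κ * Qf y with hφ₁
  have hκQC : ∀ k : ℝ, ContDiff ℝ 2 (fun y => k * Qf y) := fun k => contDiff_const.mul hQC
  have F1 := H1 φ₁ (hTC.add (hκQC κ)) (by simp [hφ₁, hTx, hQx]) (by
    filter_upwards [hnear] with y hy
    have := (abs_le.1 hy).2
    simp only [hφ₁]; linarith)
  -- second test function
  set G : Heis n → ℝ := fun y => T y + (-κ) * Qf y with hG
  have hGC : ContDiff ℝ 2 G := hTC.add (hκQC (-κ))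
  have hGx : G x = u x := by simp [hG, hTx, hQx]
  set k := -(f (u x) + ε * zsq x + v x - ℓ x) with hk
  set φ₂ : Heis n → ℝ := fun y => (f (G y) + (ε * zsq y + (-ℓ) y)) + k with hφ₂
  have hfGC : ContDiff ℝ 2 (fun y => f (G y)) := hfC.comp hGC
  have hzC : ContDiff ℝ 2 (fun y : Heis n => ε * zsq y) := contDiff_const.mul contDiff_zsq
  have hlC : ContDiff ℝ 2 (fun y : Heis n => (-ℓ) y) := (-ℓ).contDiff
  have hφ₂C : ContDiff ℝ 2 φ₂ := (hfGC.add (hzC.add hlC)).add contDiff_const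
  have hf'c : Continuous f' := continuous_iff_continuousAt.2 fun s => (hf' s).continuousAt
  have F2 := H2 φ₂ hφ₂C (by simp only [hφ₂, hGx, hk, _root_.neg_apply]; ring) (by
    have hpos : ∀ᶠ y in 𝓝 x, 0 < f' (G y) := by
      have hcont : ContinuousAt (fun y => f' (G y)) x :=
        (hf'c.comp hGC.continuous).continuousAt
      refine hcont.eventually (lt_mem_nhds ?_)
      show 0 < f' (G x)
      rw [hGx]; linarith
    filter_upwards [hnear, hmax, hpos] with y h1 h2 h3
    have h4 := (abs_le.1 h1).1
    have h5 := hconv (G y) (u y)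
    have h6 : 0 ≤ f' (G y) * (u y - G y) := by
      refine mul_nonneg h3.le ?_
      simp only [hG]; linarith
    simp only [hφ₂, hk, _root_.neg_apply]
    linarith)
  -- compute
  have e1 : Fop (LquadC a b c) φ₁ x = (H + κ • Q) + LquadC a b c x (φ₁ x) P := by
    have hg : hGrad φ₁ x = P := by
      rw [hφ₁, hGrad_add hTC (hκQC κ), hGrad_const_mul hQC, hGrad_Nq_sub, smul_zero, add_zero]
    rw [Fop, hg, hφ₁, hHessSym_add hTC (hκQC κ), hHessSym_const_mul hQC]
  have hgG : hGrad G x = P := by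
    rw [hG, hGrad_add hTC (hκQC _), hGrad_const_mul hQC, hGrad_Nq_sub, smul_zero, add_zero]
  have hHG : hHessSym G x = H + (-κ) • Q := by
    rw [hG, hHessSym_add hTC (hκQC _), hHessSym_const_mul hQC]
  have e2 : Fop (LquadC a b c) φ₂ x = (σ • (H + (-κ) • Q) + (K * t) • vecMulVec P P +
      ε • (2 : ℝ) • (1 : HMat n)) + LquadC a b c x (φ₂ x) (σ • P + q) := by
    have hg : hGrad φ₂ x = σ • P + q := by
      rw [hφ₂, hGrad_add_const, hGrad_add hfGC (hzC.add hlC), hGrad_add hzC hlC, hGrad_comp hGC hf,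
        hGrad_const_mul contDiff_zsq, hgG, hGx, hqd]
    have hh : hHessSym φ₂ x = σ • (H + (-κ) • Q) + (K * t) • vecMulVec P P +
      ε • (2 : ℝ) • (1 : HMat n) := by
      rw [hφ₂, hHessSym_add_const, hHessSym_add hfGC (hzC.add hlC), hHessSym_add hzC hlC,
        hHessSym_comp hGC hf hf', hHessSym_const_mul contDiff_zsq, hHG, hgG, hGx, hf2,
        hHessSym_clm, hHessSym_zsq, add_zero]
    rw [Fop, hg, hh]
  apply F2
  have hσF1 : σ • Fop (LquadC a b c) φ₁ x ∈ closure S := by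
    have hmaps : Set.MapsTo (fun A : HMat n => σ • A) S S :=
      fun A hA => hScone A hA σ (by linarith)
    exact map_mem_closure (continuous_const_smul σ) F1 hmaps
  set B0 : HMat n := (((2 * ε) • (1 : HMat n) + (K * t) • vecMulVec P P) +
    LquadC a b c x (φ₂ x) (σ • P + q) - σ • LquadC a b c x (φ₁ x) P) with hB0
  have e3 : Fop (LquadC a b c) φ₂ x =
      σ • Fop (LquadC a b c) φ₁ x + (B0 - (2 * κ * σ) • Q) := by
    rw [e1, e2, hB0]
    module
  rw [e3]
  refine closure_add_mem hSsymm hSpos hσF1 ?_ (half_pos hε) ?_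
  · have hS1 : (Fop (LquadC a b c) φ₁ x).IsSymm := by
      rw [Fop]; exact (hHessSym_symm _ _).add (LquadC_symm ..)
    have hS2 : (Fop (LquadC a b c) φ₂ x).IsSymm := by
      rw [Fop]; exact (hHessSym_symm _ _).add (LquadC_symm ..)
    have : B0 - (2 * κ * σ) • Q = Fop (LquadC a b c) φ₂ x - σ • Fop (LquadC a b c) φ₁ x := by
      rw [e3]; abel
    rw [this]
    exact hS2.sub (hS1.smul σ)
  · intro w
    have h1 := key_matrix ht ht2 hs hf1 hK hb hc x x (φ₂ x) (φ₁ x) P q w hq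
    have h2 := (abs_le.1 (quad_bound Q w)).2
    have h0 := dot_self_nonneg w
    rw [Matrix.sub_mulVec, dotProduct_sub, Matrix.smul_mulVec, dotProduct_smul, smul_eq_mul]
    have h3 : (2 * κ * σ) * (w ⬝ᵥ (Q *ᵥ w)) ≤ (2 * κ * σ) * (SQ * (w ⬝ᵥ w)) := by gcongr
    have h4 : (2 * κ * σ) * (SQ * (w ⬝ᵥ w)) ≤ ε / 2 * (w ⬝ᵥ w) := by
      have : 2 * σ * (κ * SQ) ≤ 3 * (ε / 8) := by
        have := mul_le_mul (show 2 * σ ≤ 3 by linarith) hκ8 (by positivity) (by norm_num)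
        linarith
      nlinarith
    linarith

end Local

section Comparison

variable {n : ℕ}

lemma norm_vecField_le (j : HIdx n) (x : Heis n) : ‖vecField j x‖ ≤ 1 + 2 * ‖x‖ := by
  obtain ⟨h1, h2, h3⟩ := coord_le_norm x
  have h0 := norm_nonneg x
  have hsing : ∀ j : Fin n, ‖(Pi.single j 1 : Fin n → ℝ)‖ ≤ 1 + 2 * ‖x‖ := by
    intro j
    refine (pi_norm_le_iff_of_nonneg (by positivity)).2 fun i => ?_
    by_cases h : i = j
    · subst h; simp
    · simp only [Pi.single_apply, h, if_false, norm_zero]; positivity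
  generalize ‖x‖ = N at *
  rcases j with j | j
  · simp only [vecField, Prod.norm_def]
    refine max_le (hsing j) (max_le (by simp only [norm_zero]; positivity) ?_)
    rw [Real.norm_eq_abs, abs_mul, abs_of_pos (by norm_num : (0:ℝ) < 2)]
    linarith [h2 j]
  · simp only [vecField, Prod.norm_def]
    refine max_le (by simp only [norm_zero]; positivity) (max_le (hsing j) ?_)
    rw [Real.norm_eq_abs, abs_neg, abs_mul, abs_of_pos (by norm_num : (0:ℝ) < 2)]
    linarith [h1 j]

lemma q_bound {ε R : ℝ} (hε : 0 ≤ ε) {x : Heis n} (hx : ‖x‖ ≤ R) {ℓ : Heis n →L[ℝ] ℝ}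
    (hℓ : ‖ℓ‖ ≤ ε) {q : HIdx n → ℝ} (hq : q = ε • hGrad zsq x + hGrad (fun ξ => (-ℓ) ξ) x) :
    q ⬝ᵥ q ≤ ((Fintype.card (HIdx n) : ℝ) * (4 * R + 1) ^ 2) * ε ^ 2 := by
  obtain ⟨h1, h2, h3⟩ := coord_le_norm x
  have hb : ∀ j, |q j| ≤ (4 * R + 1) * ε := by
    intro j
    have e : q j = ε * hGrad zsq x j + -(ℓ (vecField j x)) := by
      rw [hq, hGrad_clm]; rfl
    have g1 : |hGrad zsq x j| ≤ 2 * R := by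
      rcases j with j | j
      · rw [hGrad_zsq_inl, abs_mul, abs_of_pos (by norm_num : (0:ℝ) < 2)]
        linarith [h1 j]
      · rw [hGrad_zsq_inr, abs_mul, abs_of_pos (by norm_num : (0:ℝ) < 2)]
        linarith [h2 j]
    have g2 : |ℓ (vecField j x)| ≤ ε * (1 + 2 * R) := by
      have := ℓ.le_of_opNorm_le hℓ (vecField j x)
      rw [Real.norm_eq_abs] at this
      refine this.trans ?_
      have := norm_vecField_le j x
      gcongr
      linarith
    rw [e]
    refine (abs_add_le _ _).trans ?_
    rw [abs_neg, abs_mul, abs_of_nonneg hε]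
    have := mul_le_mul_of_nonneg_left g1 hε
    linarith
  have : q ⬝ᵥ q ≤ ∑ j : HIdx n, ((4 * R + 1) * ε) ^ 2 := by
    refine Finset.sum_le_sum fun j _ => ?_
    rw [← sq, ← sq_abs]
    have := hb j
    gcongr
  rw [Finset.sum_const, Finset.card_univ, nsmul_eq_mul] at this
  linarith [this]

lemma comparison (Ω : Set (Heis n)) (hΩopen : IsOpen Ω) (hΩbdd : Bornology.IsBounded Ω)
    (S : Set (HMat n)) (hSsymm : ∀ A ∈ S, A.IsSymm)
    (hSpos : ∀ A ∈ S, ∀ B : HMat n, B.PosDef → A + B ∈ S)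
    (hScone : ∀ A ∈ S, ∀ c : ℝ, 0 < c → c • A ∈ S)
    (a b c : ℝ)
    (hstruct : (0 < b ∧ 0 ≤ c) ∨ (b < 0 ∧ c ≤ 0) ∨ (b = 0 ∧ c = 0))
    (ψ₁ ψ₂ : Heis n → ℝ)
    (hψ₁cont : ContinuousOn ψ₁ (closure Ω)) (hψ₂cont : ContinuousOn ψ₂ (closure Ω))
    (hψ₁sub : IsSubsolution Ω (LquadC a b c) S (fun ξ => ((ψ₁ ξ : ℝ) : EReal)))
    (hψ₂super : IsSupersolution Ω (LquadC a b c) S (fun ξ => ((ψ₂ ξ : ℝ) : EReal)))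
    (hbdry : ∀ ξ ∈ frontier Ω, ψ₁ ξ = ψ₂ ξ) :
    ∀ ξ ∈ closure Ω, ψ₁ ξ ≤ ψ₂ ξ := by
  by_contra! hcon
  obtain ⟨z, hz, hlt⟩ := hcon
  have hC : IsCompact (closure Ω) := hΩbdd.isCompact_closure
  obtain ⟨g0, hg0⟩ : ∃ g0, g0 = ψ₁ z - ψ₂ z := ⟨_, rfl⟩
  have hg0p : 0 < g0 := by rw [hg0]; linarith
  obtain ⟨s0, hs0, hs0b, hs0c⟩ : ∃ s0 : ℝ, (s0 = 1 ∨ s0 = -1) ∧ s0 * b ≤ 0 ∧ s0 * c ≤ 0 := by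
    rcases hstruct with ⟨h1, h2⟩ | ⟨h1, h2⟩ | ⟨h1, h2⟩
    · exact ⟨-1, Or.inr rfl, by linarith, by linarith⟩
    · exact ⟨1, Or.inl rfl, by linarith, by linarith⟩
    · exact ⟨1, Or.inl rfl, by linarith, by linarith⟩
  obtain ⟨C1, hC1⟩ := hC.exists_bound_of_continuousOn hψ₁cont
  obtain ⟨C2, hC2⟩ := hC.exists_bound_of_continuousOn hψ₂cont
  obtain ⟨C0, hC01, hC02⟩ : ∃ C0, C1 ≤ C0 ∧ C2 ≤ C0 := ⟨max C1 C2, le_max_left _ _, le_max_right _ _⟩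
  have hb1 : ∀ x ∈ closure Ω, |ψ₁ x| ≤ C0 := fun x hx => (hC1 x hx).trans hC01
  have hb2 : ∀ x ∈ closure Ω, |-ψ₂ x| ≤ C0 := fun x hx => by
    rw [abs_neg]; exact (hC2 x hx).trans hC02
  have hC00 : 0 ≤ C0 := (abs_nonneg _).trans (hb1 z hz)
  obtain ⟨R, hR⟩ := hC.isBounded.exists_norm_le
  have hR0 : 0 ≤ R := (norm_nonneg _).trans (hR z hz)
  obtain ⟨K, hKdef⟩ : ∃ K, K = 4 * |a| + 1 := ⟨_, rfl⟩
  have hK0 : 0 < K := by rw [hKdef]; positivity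
  have hKa : 4 * |a| ≤ K := by rw [hKdef]; linarith
  obtain ⟨M, hM⟩ : ∃ M, M = s0 * K := ⟨_, rfl⟩
  have hM2 : M * M = K * K := by
    rcases hs0 with h | h <;> rw [hM, h] <;> ring
  have hMabs : |M| = K := by
    rcases hs0 with h | h <;> rw [hM, h] <;> simp [hK0.le]
  have hexpb : ∀ s, |s| ≤ C0 → Real.exp (-(K * C0)) ≤ Real.exp (M * s) ∧
      Real.exp (M * s) ≤ Real.exp (K * C0) := by
    intro s hs
    have h1 : |M * s| ≤ K * C0 := by
      rw [abs_mul, hMabs]; gcongr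
    rw [abs_le] at h1
    exact ⟨Real.exp_le_exp.2 h1.1, Real.exp_le_exp.2 h1.2⟩
  obtain ⟨X, hX⟩ : ∃ X, X = Real.exp (K * C0) := ⟨_, rfl⟩
  obtain ⟨Y, hY⟩ : ∃ Y, Y = Real.exp (-(K * C0)) := ⟨_, rfl⟩
  rw [← hX, ← hY] at hexpb
  have hX0 : 0 < X := by rw [hX]; exact Real.exp_pos _
  have hY0 : 0 < Y := by rw [hY]; exact Real.exp_pos _
  obtain ⟨δ, hδ0, hδ1, hδ2⟩ : ∃ δ : ℝ, 0 < δ ∧ δ * K * X ≤ 1 / 2 ∧ δ * X ≤ g0 / 4 := by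
    refine ⟨min (1 / (2 * K * X)) (g0 / (4 * X)), lt_min (by positivity) (by positivity), ?_, ?_⟩
    · have := min_le_left (1 / (2 * K * X)) (g0 / (4 * X))
      calc _ ≤ (1 / (2 * K * X)) * K * X := by gcongr
        _ = 1 / 2 := by field_simp
    · have := min_le_right (1 / (2 * K * X)) (g0 / (4 * X))
      calc _ ≤ (g0 / (4 * X)) * X := by gcongr
        _ = g0 / 4 := by field_simp
  obtain ⟨f, hfd⟩ : ∃ f : ℝ → ℝ, f = fun s => s + δ * Real.exp (M * s) := ⟨_, rfl⟩
  obtain ⟨f', hf'd⟩ : ∃ f' : ℝ → ℝ, f' = fun s => 1 + δ * (Real.exp (M * s) * M) := ⟨_, rfl⟩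
  obtain ⟨f'', hf''d⟩ : ∃ f'' : ℝ → ℝ, f'' = fun s => δ * (Real.exp (M * s) * M * M) := ⟨_, rfl⟩
  have hder : ∀ s, HasDerivAt (fun s => Real.exp (M * s)) (Real.exp (M * s) * M) s := by
    intro s
    have := ((hasDerivAt_id s).const_mul M).exp
    simpa using this
  have hfder : ∀ s, HasDerivAt f (f' s) s := by
    intro s
    rw [hfd, hf'd]
    exact (hasDerivAt_id s).add ((hder s).const_mul δ)
  have hf'der : ∀ s, HasDerivAt f' (f'' s) s := by
    intro s
    rw [hf'd, hf''d]
    exact (((hder s).mul_const M).const_mul δ).const_add 1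
  have hfC : ContDiff ℝ 2 f := by rw [hfd]; fun_prop
  have hconv : ∀ s t, f s + f' s * (t - s) ≤ f t := by
    intro s t
    have h1 := Real.add_one_le_exp (M * (t - s))
    have h2 : Real.exp (M * t) = Real.exp (M * s) * Real.exp (M * (t - s)) := by
      rw [← Real.exp_add]; congr 1; ring
    have h3 := mul_le_mul_of_nonneg_left h1 (mul_pos hδ0 (Real.exp_pos (M * s))).le
    rw [hfd, hf'd]
    simp only [h2]
    linarith
  have htb : ∀ s, |s| ≤ C0 → δ * K * Y ≤ δ * K * Real.exp (M * s) ∧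
      δ * K * Real.exp (M * s) ≤ 1 / 2 := by
    intro s hs
    obtain ⟨h1, h2⟩ := hexpb s hs
    exact ⟨by gcongr, le_trans (by gcongr) hδ1⟩
  have hf'eq : ∀ s, f' s = 1 + s0 * (δ * K * Real.exp (M * s)) := by
    intro s
    rw [hf'd]
    simp only
    nth_rewrite 2 [hM]
    ring
  have hf''eq : ∀ s, f'' s = K * (δ * K * Real.exp (M * s)) := by
    intro s
    rw [hf''d]
    simp only
    rw [mul_assoc (Real.exp (M * s)), hM2]
    ring
  have hf'b : ∀ s, |s| ≤ C0 → 1 / 2 ≤ f' s ∧ f' s ≤ 2 := by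
    intro s hs
    have h1 := (htb s hs).2
    have h2 : 0 ≤ δ * K * Real.exp (M * s) := by positivity
    rw [hf'eq s]
    rcases hs0 with h | h <;> rw [h] <;> constructor <;> linarith
  have hmono : MonotoneOn f (Set.Icc (-C0) C0) := by
    intro s hs t ht hst
    have h1 := (hf'b s (abs_le.2 hs)).1
    have h2 := hconv s t
    have := mul_nonneg (show 0 ≤ f' s by linarith) (sub_nonneg.2 hst)
    linarith
  obtain ⟨W, hW⟩ : ∃ W, W = 3 * (|a| + |b| + |c|) := ⟨_, rfl⟩
  have hW0 : 0 ≤ W := by rw [hW]; positivity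
  obtain ⟨Cq, hCq⟩ : ∃ Cq, Cq = (Fintype.card (HIdx n) : ℝ) * (4 * R + 1) ^ 2 := ⟨_, rfl⟩
  have hCq0 : 0 ≤ Cq := by rw [hCq]; positivity
  obtain ⟨ε, hε0, hε1, hε2⟩ : ∃ ε : ℝ, 0 < ε ∧ ε * (2 * n * R ^ 2) ≤ g0 / 4 ∧
      ε * (Cq * W) ≤ δ * K * Y := by
    refine ⟨min (g0 / (4 * (2 * n * R ^ 2 + 1))) (δ * K * Y / (Cq * W + 1)),
      lt_min (by positivity) (by positivity), ?_, ?_⟩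
    · have := min_le_left (g0 / (4 * (2 * n * R ^ 2 + 1))) (δ * K * Y / (Cq * W + 1))
      calc _ ≤ (g0 / (4 * (2 * n * R ^ 2 + 1))) * (2 * n * R ^ 2 + 1) := by
            gcongr; linarith
        _ = g0 / 4 := by field_simp
    · have := min_le_right (g0 / (4 * (2 * n * R ^ 2 + 1))) (δ * K * Y / (Cq * W + 1))
      calc _ ≤ (δ * K * Y / (Cq * W + 1)) * (Cq * W + 1) := by
            gcongr; linarith
        _ = δ * K * Y := by field_simp
  have hzb : ∀ x ∈ closure Ω, ε * zsq x ≤ g0 / 4 := by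
    intro x hx
    refine le_trans ?_ hε1
    have := hR x hx
    refine mul_le_mul_of_nonneg_left ((zsq_le x).trans ?_) hε0.le
    gcongr
  have hbd : ∀ a ∈ frontier Ω, f (ψ₁ a) + ε * zsq a + -ψ₂ a < f (ψ₁ z) + ε * zsq z + -ψ₂ z := by
    intro a ha
    have haC : a ∈ closure Ω := frontier_subset_closure ha
    have h1 := hzb a haC
    have h2 := (hexpb _ (hb1 a haC)).2
    have h3 : δ * Real.exp (M * ψ₁ a) ≤ δ * X := by gcongr
    have h4 : 0 < δ * Real.exp (M * ψ₁ z) := by positivity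
    have h5 := mul_nonneg hε0.le (zsq_nonneg z)
    have h6 := hbdry a ha
    rw [hfd]
    simp only
    linarith
  have hne : (closure Ω).Nonempty := ⟨z, hz⟩
  have hχcont : ContinuousOn (fun ξ => -ψ₂ ξ) (closure Ω) := hψ₂cont.neg
  choose u hu using fun k : ℕ => exists_supConv hC hne hψ₁cont ((k : ℝ) + 1)
  choose v hv using fun k : ℕ => exists_supConv hC hne hχcont ((k : ℝ) + 1)
  have hgc : Continuous (fun x : Heis n => ε * zsq x) :=
    continuous_const.mul contDiff_zsq.continuous
  obtain ⟨k, hk⟩ := select hΩopen hC hψ₁cont hχcont hb1 hb2 hu hv hfC.continuous hgc hmono hz hbd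
  have hl0 : (0 : ℝ) ≤ (k : ℝ) + 1 := by positivity
  have hukb : ∀ x ∈ closure Ω, |u k x| ≤ C0 := fun x hx => supConv_abs hl0 hb1 (hu k) hx
  obtain ⟨r, hr0, hrε, hrk⟩ : ∃ r : ℝ, 0 < r ∧ r ≤ ε ∧ r ≤ 1 / ((k : ℝ) + 1) :=
    ⟨min ε (1 / ((k : ℝ) + 1)), lt_min hε0 (by positivity), min_le_left _ _, min_le_right _ _⟩
  obtain ⟨Φ, hΦ⟩ : ∃ Φ : Heis n → ℝ, Φ = fun x => f (u k x) + ε * zsq x + v k x := ⟨_, rfl⟩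
  have hΦc : Continuous Φ := by
    rw [hΦ]
    exact ((hfC.continuous.comp (hu k).cont).add hgc).add (hv k).cont
  obtain ⟨E, hE⟩ : ∃ E : Set (Heis n), E = {x | x ∈ closure Ω ∧ ∃ ℓ : Heis n →L[ℝ] ℝ, ‖ℓ‖ ≤ r ∧
    ∀ y ∈ closure Ω, Φ y - ℓ y ≤ Φ x - ℓ x} := ⟨_, rfl⟩
  have hEcpt : IsCompact E := by
    have hprop : ProperSpace (Heis n →L[ℝ] ℝ) := FiniteDimensional.proper ℝ _
    have hcl : IsClosed {p : Heis n × (Heis n →L[ℝ] ℝ) |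
        ∀ y ∈ closure Ω, Φ y - p.2 y ≤ Φ p.1 - p.2 p.1} := by
      have : {p : Heis n × (Heis n →L[ℝ] ℝ) |
        ∀ y ∈ closure Ω, Φ y - p.2 y ≤ Φ p.1 - p.2 p.1} = ⋂ y ∈ closure Ω,
          {p : Heis n × (Heis n →L[ℝ] ℝ) | Φ y - p.2 y ≤ Φ p.1 - p.2 p.1} := by
        ext p; simp
      rw [this]
      refine isClosed_biInter fun y _ => isClosed_le ?_ ?_
      · exact continuous_const.sub (continuous_snd.clm_apply continuous_const)
      · exact (hΦc.comp continuous_fst).sub (continuous_snd.clm_apply continuous_fst)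
    have hcp := (hC.prod (isCompact_closedBall (0 : Heis n →L[ℝ] ℝ) r)).inter_right hcl
    have : E = Prod.fst '' ((closure Ω ×ˢ Metric.closedBall (0 : Heis n →L[ℝ] ℝ) r) ∩
        {p : Heis n × (Heis n →L[ℝ] ℝ) | ∀ y ∈ closure Ω, Φ y - p.2 y ≤ Φ p.1 - p.2 p.1}) := by
      rw [hE]
      ext x
      constructor
      · rintro ⟨hx, ℓ, hℓ, h⟩
        exact ⟨(x, ℓ), ⟨⟨hx, by simpa using hℓ⟩, h⟩, rfl⟩
      · rintro ⟨⟨x', ℓ⟩, ⟨⟨hx, hℓ⟩, h⟩, rfl⟩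
        exact ⟨hx, ℓ, by simpa using hℓ, h⟩
    rw [this]
    exact hcp.image continuous_fst
  have hEΩ : ∀ x ∈ E, ∃ ℓ : Heis n →L[ℝ] ℝ, ‖ℓ‖ ≤ r ∧ (∀ y ∈ closure Ω, Φ y - ℓ y ≤ Φ x - ℓ x) ∧
      x ∈ Ω ∧ (∃ η ∈ Ω, u k x = ψ₁ η - ((k : ℝ) + 1) * Nq (hmul η (hinv x))) ∧
      (∃ θ ∈ Ω, v k x = -ψ₂ θ - ((k : ℝ) + 1) * Nq (hmul θ (hinv x))) := by
    intro x hx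
    rw [hE] at hx
    obtain ⟨hxC, ℓ, hℓ, hmax⟩ := hx
    obtain ⟨η, hη, heη⟩ := (hu k).att x
    obtain ⟨θ, hθ, heθ⟩ := (hv k).att x
    have hmax' := hmax
    rw [hΦ] at hmax'
    obtain ⟨h1, h2, h3⟩ := hk ℓ (hℓ.trans hrk) x hxC hmax' η hη heη θ hθ heθ
    exact ⟨ℓ, hℓ, hmax, h1, ⟨η, h2, heη⟩, ⟨θ, h3, heθ⟩⟩
  have hEsub : E ⊆ Ω := fun x hx => by
    obtain ⟨_, _, _, h, _⟩ := hEΩ x hx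
    exact h
  obtain ⟨ρ, hρ0, hρ⟩ := hEcpt.exists_cthickening_subset_open hΩopen hEsub
  have hball : ∀ x ∈ E, Metric.closedBall x ρ ⊆ Ω := fun x hx =>
    (Metric.closedBall_subset_cthickening hx ρ).trans hρ
  have hEC : ∀ x ∈ E, x ∈ closure Ω := fun x hx => subset_closure (hEsub hx)
  have hjen := jensen_apply (E := E) (D := 2 * R) (r := r)
    (K := ((k : ℝ) + 1) * ((2 * n + 1) * (1 + 4 * n * R) ^ 2))
    (g := fun x : Heis n => ε * zsq x) (u := u k) (v := v k) hΩopen hρ0 (by positivity) hr0 hball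
    (fun x hx y hy => by
      have h1 := hR x (hEC x hx)
      have h2 := hR y (hEC y hy)
      linarith [norm_sub_le x y]) hconv
    ((hu k).semiconvex hl0 hR) ((hv k).semiconvex hl0 hR)
    (fun x => ⟨ε • zB x, fun y => by
      have := mul_le_mul_of_nonneg_left (zsq_convex x y) hε0.le
      simp only [_root_.smul_apply, smul_eq_mul]
      linarith⟩)
    (fun x hx => (hf'b _ (hukb x (hEC x hx))).1) (fun x hx => (hf'b _ (hukb x (hEC x hx))).2)
    (fun ℓ hℓ => by
      obtain ⟨x, hx, hmax⟩ := hC.exists_isMaxOn hne (hΦc.sub ℓ.continuous).continuousOn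
      have hmax' : ∀ y ∈ closure Ω, Φ y - ℓ y ≤ Φ x - ℓ x := fun y hy => hmax hy
      refine ⟨x, by rw [hE]; exact ⟨hx, ℓ, hℓ, hmax'⟩, fun y hy => ?_⟩
      have h1 := hmax' y (subset_closure hy)
      rw [hΦ] at h1
      rw [map_sub]
      simp only at h1
      linarith)
    (fun x hx => by
      obtain ⟨ℓ, -, hmax, -⟩ := hEΩ x hx
      refine ⟨ℓ, fun y hy => ?_⟩
      have h1 := hmax y (subset_closure hy)
      rw [hΦ] at h1
      rw [map_sub]
      simp only at h1
      linarith)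
  obtain ⟨x, hxE, p, A, hexp⟩ := hjen
  obtain ⟨ℓ, hℓ, hmax, hxΩ, ⟨η, hη, heη⟩, ⟨θ, hθ, heθ⟩⟩ := hEΩ x hxE
  have hxC := hEC x hxE
  obtain ⟨ht1, ht2⟩ := htb _ (hukb x hxC)
  have hqb := q_bound hε0.le (hR x hxC) (hℓ.trans hrε) rfl
  rw [← hCq] at hqb
  refine local_contra hSsymm hSpos hScone (t := δ * K * Real.exp (M * u k x)) hε0 (by positivity)
    ht2 hs0 hKa hs0b hs0c hfC hfder hf'der hconv (hf'eq _) (hf''eq _) hexp (ℓ := ℓ) (v := v k) ?_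
    (fun φ hφ h1 h2 => touch_sub hψ₁sub (hu k) hη heη hφ h1 h2)
    (fun φ hφ h1 h2 => touch_super hψ₂super (hv k) hθ heθ hφ h1 h2) rfl ?_
  · filter_upwards [hΩopen.mem_nhds hxΩ] with y hy
    have h1 := hmax y (subset_closure hy)
    rw [hΦ] at h1
    exact h1
  · rw [← hW]
    calc _ ≤ (Cq * ε ^ 2) * W := by gcongr
      _ = ε * (ε * (Cq * W)) := by ring
      _ ≤ ε * (δ * K * Y) := by gcongr
      _ ≤ _ := by gcongr

end Comparison

/-- Uniqueness for the Dirichlet problem. -/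
theorem uniqueness_dirichlet_problem
    {n : ℕ} (hn : 1 ≤ n)
    (Ω : Set (Heis n)) (hΩopen : IsOpen Ω) (hΩbdd : Bornology.IsBounded Ω)
    (S : Set (HMat n)) (hSne : S.Nonempty) (hSsymm : ∀ A ∈ S, A.IsSymm)
    (hSopen : RelOpen S)
    (hSpos : ∀ A ∈ S, ∀ B : HMat n, B.PosDef → A + B ∈ S)
    (hScone : ∀ A ∈ S, ∀ c : ℝ, 0 < c → c • A ∈ S)
    (a b c : ℝ)
    (hstruct : (0 < b ∧ 0 ≤ c) ∨ (b < 0 ∧ c ≤ 0) ∨ (b = 0 ∧ c = 0))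
    (φb : Heis n → ℝ) (hφb : ContinuousOn φb (frontier Ω))
    (ψ₁ ψ₂ : Heis n → ℝ)
    (hψ₁cont : ContinuousOn ψ₁ (closure Ω)) (hψ₂cont : ContinuousOn ψ₂ (closure Ω))
    (hψ₁sub : IsSubsolution Ω (LquadC a b c) S (fun ξ => ((ψ₁ ξ : ℝ) : EReal)))
    (hψ₁super : IsSupersolution Ω (LquadC a b c) S (fun ξ => ((ψ₁ ξ : ℝ) : EReal)))
    (hψ₂sub : IsSubsolution Ω (LquadC a b c) S (fun ξ => ((ψ₂ ξ : ℝ) : EReal)))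
    (hψ₂super : IsSupersolution Ω (LquadC a b c) S (fun ξ => ((ψ₂ ξ : ℝ) : EReal)))
    (hψ₁bdry : ∀ ξ ∈ frontier Ω, ψ₁ ξ = φb ξ)
    (hψ₂bdry : ∀ ξ ∈ frontier Ω, ψ₂ ξ = φb ξ) :
    Set.EqOn ψ₁ ψ₂ (closure Ω) := by
  have h : ∀ ξ ∈ frontier Ω, ψ₁ ξ = ψ₂ ξ := fun ξ hξ => by rw [hψ₁bdry ξ hξ, hψ₂bdry ξ hξ]
  intro ξ hξ
  exact le_antisymm
    (comparison Ω hΩopen hΩbdd S hSsymm hSpos hScone a b c hstruct ψ₁ ψ₂ hψ₁cont hψ₂cont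
      hψ₁sub hψ₂super h ξ hξ)
    (comparison Ω hΩopen hΩbdd S hSsymm hSpos hScone a b c hstruct ψ₂ ψ₁ hψ₂cont hψ₁cont
      hψ₂sub hψ₁super (fun ξ hξ => (h ξ hξ).symm) ξ hξ)
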